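/- arXiv:2605.25380 — 5 statements merged into one kernel-verified Lean document; each statement's English description precedes it below -/
import Mathlib

section
/- Let r ≥ 1 and n ≥ max(r, 2) be integers. Set a_i = i − (n+1)/2 for 1 ≤ i ≤ n and c_{ρ,n} = 12/(n(n²−1)). For a partition λ = (λ_1 ≥ ⋯ ≥ λ_ℓ ≥ 1) of r with ℓ = ℓ(λ) parts, let m_j(λ) = #{b : λ_b = j}, let D_λ(n) = Σ over pairwise distinct indices i_1, …, i_ℓ ∈ {1,…,n} of Π_{b=1}^{ℓ} a_{i_b}^{λ_b}, and let (n)_ℓ = n(n−1)⋯(n−ℓ+1) be the falling factorial. Then the r-th null moment of Spearman's rho satisfies M_{ρ,r}(n) = c_{ρ,n}^r Σ_{λ ⊢ r} [ r! / (Π_{b=1}^{ℓ(λ)} λ_b! · Π_{j ≥ 1} m_j(λ)!) ] · D_λ(n)² / (n)_{ℓ(λ)}, where the sum is over all integer partitions λ of r. -/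
open Finset Equiv

section SupportedFamilies

variable {α β : Type*} [Fintype α] [Fintype β] {k : α → ℕ} {L : β → ℕ}

/-- If `k` restricts to `L` along `f` and both have the same sum, then `k` vanishes off `f`. -/
lemma eq_zero_of_notMem_range_of_sum_eq (f : β ↪ α) (hf : ∀ b, k (f b) = L b)
    (hsum : ∑ i, k i = ∑ b, L b) {i : α} (hi : i ∉ Set.range f) : k i = 0 := by
  classical
  have hmap : ∑ j ∈ univ.map f, k j = ∑ b, L b := by simp [hf]
  have hadd := sum_add_sum_compl (univ.map f) k
  have hzero : ∑ j ∈ (univ.map f)ᶜ, k j = 0 := by omega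
  exact sum_eq_zero_iff.1 hzero i (by simpa using hi)

/-- The nonzero values of `k` are the values of its positive restriction `L`. -/
lemma map_univ_eq_filter_ne_zero (f : β ↪ α) (hL : ∀ b, L b ≠ 0) (hf : ∀ b, k (f b) = L b)
    (hk : ∀ i ∉ Set.range f, k i = 0) :
    univ.val.map L = (univ.val.map k).filter (· ≠ 0) := by
  classical
  have hsupp : univ.filter (fun i => k i ≠ 0) = univ.map f := by
    ext i
    simp only [mem_filter, mem_univ, true_and, mem_map]
    constructor
    · intro h
      by_contra hi
      exact h (hk i hi)
    · rintro ⟨b, rfl⟩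
      rw [hf]
      exact hL b
  have hval := congrArg Finset.val hsupp
  rw [filter_val, map_val] at hval
  rw [Multiset.filter_map]
  change _ = Multiset.map k (Multiset.filter (fun i => k i ≠ 0) _)
  rw [hval, Multiset.map_map]
  exact Multiset.map_congr rfl fun b _ => (hf b).symm

/-- Conversely, a family of the nonzero values of `k` can be indexed by the support of `k`. -/
lemma exists_embedding_of_map_univ_eq (h : univ.val.map L = (univ.val.map k).filter (· ≠ 0)) :
    ∃ f : β ↪ α, (∀ b, k (f b) = L b) ∧ ∀ i, k i ≠ 0 → i ∈ Set.range f := by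
  classical
  have hcard (c : ℕ) :
      Fintype.card {b // L b = c} = Fintype.card {i : {i // k i ≠ 0} // k i = c} := by
    have hc := congrArg (Multiset.count c) h
    rw [Multiset.count_filter] at hc
    rw [Fintype.card_congr (Equiv.subtypeSubtypeEquivSubtypeInter _ (fun i => k i = c)),
      Fintype.card_subtype, Fintype.card_subtype]
    simp only [Multiset.count_map] at hc
    rw [card_def, card_def, filter_val, filter_val]
    simp only [eq_comm (a := c)] at hc
    rw [hc]
    split_ifs with h0
    · congr 1
      refine Multiset.filter_congr fun i _ => ⟨fun hi => ⟨hi ▸ h0, hi⟩, And.right⟩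
    · symm
      rw [Multiset.card_eq_zero, Multiset.filter_eq_nil]
      rintro i - ⟨hi, rfl⟩
      exact h0 hi
  let e : β ≃ {i // k i ≠ 0} :=
    Equiv.ofFiberEquiv (f := L) (g := fun i : {i // k i ≠ 0} => k i)
      fun c => Fintype.equivOfCardEq (hcard c)
  refine ⟨e.toEmbedding.trans (Function.Embedding.subtype _), fun b => ?_, fun i hi => ?_⟩
  · exact Equiv.ofFiberEquiv_map (f := L) (g := fun i : {i // k i ≠ 0} => k i) _ b
  · exact ⟨e.symm ⟨i, hi⟩, by simp⟩

/-- The number of ways to index the support of `k` by `L`. -/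
lemma card_embedding_comp_eq [DecidablePred fun f : β ↪ α => ∀ b, k (f b) = L b]
    (hL : ∀ b, L b ≠ 0) (h : univ.val.map L = (univ.val.map k).filter (· ≠ 0)) :
    #{f : β ↪ α | ∀ b, k (f b) = L b} =
      ∏ j ∈ (univ.val.map L).toFinset, ((univ.val.map L).count j).factorial := by
  classical
  obtain ⟨f₀, hf₀, hrange⟩ := exists_embedding_of_map_univ_eq h
  have hperm : Fintype.card {σ : Perm β // L ∘ σ = L} =
      Fintype.card {f : β ↪ α // ∀ b, k (f b) = L b} := by
    refine Fintype.card_of_bijective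
      (f := fun σ => ⟨σ.1.toEmbedding.trans f₀, fun b => ?_⟩) ⟨?_, ?_⟩
    · simpa [hf₀] using congrFun σ.2 b
    · rintro ⟨σ, hσ⟩ ⟨τ, hτ⟩ hστ
      refine Subtype.ext (Equiv.ext fun b => f₀.injective ?_)
      exact DFunLike.congr_fun (congrArg Subtype.val hστ) b
    · rintro ⟨f, hf⟩
      have hmem (b : β) : ∃ b', f₀ b' = f b := hrange (f b) (by rw [hf]; exact hL b)
      choose s hs using hmem
      have hinj : Function.Injective s := fun b b' hbb' =>
        f.injective (by rw [← hs, ← hs, hbb'])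
      refine ⟨⟨Equiv.ofBijective s (Finite.injective_iff_bijective.1 hinj), ?_⟩, ?_⟩
      · funext b
        simp [← hf₀, hs, hf]
      · exact Subtype.ext (Function.Embedding.ext fun b => hs b)
  rw [← Fintype.card_subtype, ← hperm, DomMulAct.stabilizer_card']
  refine prod_congr rfl fun j _ => ?_
  rw [Multiset.count_map, Fintype.card_subtype, card_def, filter_val]
  simp only [eq_comm]

/-- Each embedding and family of values determine a unique extension of the same sum. -/
lemma filter_piAntidiag_eq_singleton [DecidableEq α] {r : ℕ} (f : β ↪ α)
    [DecidablePred fun k : α → ℕ => ∀ b, k (f b) = L b] (hr : ∑ b, L b = r) :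
    (piAntidiag univ r).filter (fun k : α → ℕ => ∀ b, k (f b) = L b) =
      {Function.extend f L 0} := by
  have hext (b : β) : Function.extend f L 0 (f b) = L b := f.injective.extend_apply L 0 b
  have hext0 (i : α) (hi : i ∉ Set.range f) : Function.extend f L 0 i = 0 :=
    Function.extend_apply' _ _ _ hi
  ext k
  simp only [mem_filter, mem_piAntidiag, mem_univ, implies_true, and_true, mem_singleton]
  constructor
  · rintro ⟨hk, hf⟩
    funext i
    by_cases hi : i ∈ Set.range f
    · obtain ⟨b, rfl⟩ := hi
      rw [hf, hext]
    · rw [hext0 i hi, eq_zero_of_notMem_range_of_sum_eq f hf (hk.trans hr.symm) hi]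
  · rintro rfl
    refine ⟨?_, hext⟩
    rw [← hr]
    exact (Fintype.sum_of_injective f f.injective _ _ hext0 fun b => (hext b).symm).symm

end SupportedFamilies

/-- Summing a function of `f` composed with a random permutation averages it over embeddings. -/
lemma sum_perm_embedding_trans {α : Type*} [Fintype α] [DecidableEq α] {l : ℕ}
    (G : (Fin l ↪ α) → ℝ) (f : Fin l ↪ α) :
    ((Fintype.card α).descFactorial l : ℝ) * ∑ π : Perm α, G (f.trans π.toEmbedding) =
      (Fintype.card α).factorial * ∑ g, G g := by
  have hconst (g : Fin l ↪ α) : ∑ π : Perm α, G (g.trans π.toEmbedding) =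
      ∑ π : Perm α, G (f.trans π.toEmbedding) := by
    have := Perm.isMultiplyPretransitive α l
    obtain ⟨σ, rfl⟩ := MulAction.exists_smul_eq (Perm α) f g
    exact Fintype.sum_equiv (Equiv.mulRight σ) _ _ fun π => rfl
  have hshift (π : Perm α) : ∑ g : Fin l ↪ α, G (g.trans π.toEmbedding) = ∑ g, G g :=
    Fintype.sum_equiv (Equiv.embeddingCongr (Equiv.refl _) π) _ _ fun g => rfl
  have hcomm := sum_comm (s := (univ : Finset (Fin l ↪ α))) (t := (univ : Finset (Perm α)))
    (f := fun g π => G (g.trans π.toEmbedding))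
  simp only [hconst, hshift, sum_const, nsmul_eq_mul, card_univ, Fintype.card_embedding_eq,
    Fintype.card_fin, Fintype.card_perm] at hcomm
  exact hcomm

/-- The values of the list enumerating a partition. -/
lemma map_univ_sort_get (m : Multiset ℕ) :
    univ.val.map (m.sort (· ≤ ·)).get = m := by
  conv_rhs => rw [← Multiset.sort_eq m (· ≤ ·)]
  rw [Fin.univ_val_map, List.ofFn_get]

/-- The multinomial theorem grouped by integer partitions, as a sum over distinct indices. -/
lemma sum_pow_eq_sum_partition {α : Type*} [Fintype α] [DecidableEq α] (x : α → ℝ) (r : ℕ) :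
    (∑ i, x i) ^ r = ∑ lam : Nat.Partition r,
      ((r.factorial : ℝ) /
        ((((lam.parts.map Nat.factorial).prod : ℕ) : ℝ) *
          (((∏ j ∈ lam.parts.toFinset, (lam.parts.count j).factorial) : ℕ) : ℝ))) *
        ∑ f : Fin (lam.parts.sort (· ≤ ·)).length ↪ α,
          ∏ b, x (f b) ^ (lam.parts.sort (· ≤ ·)).get b := by
  let L (lam : Nat.Partition r) := (lam.parts.sort (· ≤ ·)).get
  let mult (lam : Nat.Partition r) : ℕ :=
    ∏ j ∈ lam.parts.toFinset, (lam.parts.count j).factorial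
  have hmult (lam) : (mult lam : ℝ) ≠ 0 :=
    Nat.cast_ne_zero.2 (prod_ne_zero_iff.2 fun j _ => Nat.factorial_ne_zero _)
  have hLparts (lam) : univ.val.map (L lam) = lam.parts := map_univ_sort_get _
  have hLpos (lam b) : L lam b ≠ 0 := by
    have hb : L lam b ∈ univ.val.map (L lam) := Multiset.mem_map_of_mem _ (mem_univ_val b)
    rw [hLparts] at hb
    exact (lam.parts_pos hb).ne'
  have hLsum (lam) : ∑ b, L lam b = r := by
    rw [Finset.sum, hLparts, lam.parts_sum]
  have hterm (lam : Nat.Partition r) (f : Fin (lam.parts.sort (· ≤ ·)).length ↪ α)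
      (k : α → ℕ) (hk : ∑ i, k i = r) (hf : ∀ b, k (f b) = L lam b) :
      (r.factorial : ℝ) / (((lam.parts.map Nat.factorial).prod : ℕ) : ℝ) *
        ∏ b, x (f b) ^ L lam b = Nat.multinomial univ k * ∏ i, x i ^ k i := by
    have hk0 (i : α) (hi : i ∉ Set.range f) : k i = 0 :=
      eq_zero_of_notMem_range_of_sum_eq f hf (hk.trans (hLsum lam).symm) hi
    have hpow : ∏ b, x (f b) ^ L lam b = ∏ i, x i ^ k i :=
      Fintype.prod_of_injective f f.injective _ _ (fun i hi => by simp [hk0 i hi])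
        fun b => by rw [hf]
    have hfac : (lam.parts.map Nat.factorial).prod = ∏ i, (k i).factorial := by
      rw [← hLparts, Multiset.map_map]
      exact Fintype.prod_of_injective f f.injective _ _ (fun i hi => by simp [hk0 i hi])
        fun b => by rw [hf]; rfl
    have hspec := Nat.multinomial_spec univ k
    rw [hk] at hspec
    have hne : ((∏ i, (k i).factorial : ℕ) : ℝ) ≠ 0 :=
      Nat.cast_ne_zero.2 (prod_ne_zero_iff.2 fun j _ => Nat.factorial_ne_zero _)
    rw [hpow, hfac, ← hspec, Nat.cast_mul, mul_div_cancel_left₀ _ hne]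
  have hcount (k : α → ℕ) (hk : ∑ i, k i = r) :
      ∑ lam : Nat.Partition r,
        (#{f : Fin (lam.parts.sort (· ≤ ·)).length ↪ α | ∀ b, k (f b) = L lam b} : ℝ) /
          mult lam = 1 := by
    rw [sum_eq_single (Nat.Partition.ofSums r (univ.val.map k) hk)]
    · rw [card_embedding_comp_eq (hLpos _) (by rw [hLparts]; rfl), hLparts]
      exact div_self (hmult _)
    · intro lam _ hlam
      rw [filter_eq_empty_iff.2, card_empty, Nat.cast_zero, zero_div]
      intro f _ hf
      refine hlam (Nat.Partition.ext ?_)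
      rw [← hLparts, map_univ_eq_filter_ne_zero f (hLpos lam) hf fun i hi =>
        eq_zero_of_notMem_range_of_sum_eq f hf (hk.trans (hLsum lam).symm) hi]
      rfl
    · simp
  calc (∑ i, x i) ^ r
      = ∑ k ∈ piAntidiag univ r, Nat.multinomial univ k * ∏ i, x i ^ k i :=
        sum_pow_eq_sum_piAntidiag _ _ _
    _ = ∑ k ∈ piAntidiag univ r, ∑ lam : Nat.Partition r,
          ∑ f : Fin (lam.parts.sort (· ≤ ·)).length ↪ α, if ∀ b, k (f b) = L lam b then
            (Nat.multinomial univ k * ∏ i, x i ^ k i) / mult lam else 0 := by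
        refine sum_congr rfl fun k hk => ?_
        conv_lhs => rw [← mul_one (_ * _), ← hcount k (mem_piAntidiag.1 hk).1, mul_sum]
        refine sum_congr rfl fun lam _ => ?_
        rw [← sum_filter, sum_const, nsmul_eq_mul]
        ring
    _ = ∑ lam : Nat.Partition r, ∑ f : Fin (lam.parts.sort (· ≤ ·)).length ↪ α,
          ∑ k ∈ piAntidiag univ r, if ∀ b, k (f b) = L lam b then
            (Nat.multinomial univ k * ∏ i, x i ^ k i) / mult lam else 0 := by
        rw [sum_comm]
        exact sum_congr rfl fun lam _ => sum_comm
    _ = _ := by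
        refine sum_congr rfl fun lam _ => ?_
        rw [mul_sum]
        refine sum_congr rfl fun f _ => ?_
        have hmem : Function.extend f (L lam) 0 ∈
            (piAntidiag univ r).filter (fun k : α → ℕ => ∀ b, k (f b) = L lam b) := by
          rw [filter_piAntidiag_eq_singleton f (hLsum lam)]
          exact mem_singleton_self _
        rw [mem_filter, mem_piAntidiag] at hmem
        rw [← sum_filter, filter_piAntidiag_eq_singleton f (hLsum lam), sum_singleton,
          ← hterm lam f _ hmem.1.1 hmem.2, ← div_div]
        exact (div_mul_eq_mul_div _ _ _).symm

/-- Partition identity for the `r`-th null moment of Spearman's rho. -/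
theorem stmt3 (r n : ℕ) (hr : 1 ≤ r) (hn2 : 2 ≤ n) (hrn : r ≤ n)
    (a : Fin n → ℝ) (ha : ∀ i, a i = (i : ℝ) + 1 - ((n : ℝ) + 1) / 2)
    (c : ℝ) (hc : c = 12 / ((n : ℝ) * ((n : ℝ) ^ 2 - 1)))
    (ρ : Perm (Fin n) → ℝ) (hρ : ∀ π, ρ π = c * ∑ i, a i * a (π i))
    (D : List ℕ → ℝ)
    (hD : ∀ L : List ℕ,
      D L = ∑ f : Fin L.length ↪ Fin n, ∏ b : Fin L.length, (a (f b)) ^ (L.get b)) :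
    (1 / (n.factorial : ℝ)) * ∑ π : Perm (Fin n), (ρ π) ^ r
      = c ^ r * ∑ lam : Nat.Partition r,
          ((r.factorial : ℝ) /
              ((((lam.parts.map Nat.factorial).prod : ℕ) : ℝ) *
                (((∏ j ∈ lam.parts.toFinset, (lam.parts.count j).factorial) : ℕ) : ℝ))) *
            (D (lam.parts.sort (· ≤ ·))) ^ 2 / ((n.descFactorial lam.parts.card : ℕ) : ℝ) := by
  have hfac : (n.factorial : ℝ) ≠ 0 := Nat.cast_ne_zero.2 n.factorial_ne_zero
  simp_rw [hρ, mul_pow, sum_pow_eq_sum_partition]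
  rw [← mul_sum, mul_left_comm, sum_comm, mul_sum]
  congr 1
  refine sum_congr rfl fun lam _ => ?_
  set L := lam.parts.sort (· ≤ ·) with hL
  have hlen : L.length = lam.parts.card := Multiset.length_sort ..
  have hcard : lam.parts.card ≤ n := by
    refine le_trans ?_ hrn
    have hle := Multiset.card_nsmul_le_sum (s := lam.parts) (a := 1) fun i hi => lam.parts_pos hi
    rwa [lam.parts_sum, smul_eq_mul, mul_one] at hle
  have hdesc : (n.descFactorial lam.parts.card : ℝ) ≠ 0 :=
    Nat.cast_ne_zero.2 (Nat.descFactorial_eq_zero_iff_lt.not.2 hcard.not_gt)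
  have hmain : (n.descFactorial lam.parts.card : ℝ) *
      ∑ π : Perm (Fin n), ∑ f : Fin L.length ↪ Fin n,
        ∏ b, (a (f b) * a (π (f b))) ^ L.get b = n.factorial * D L ^ 2 := by
    rw [sum_comm, mul_sum, sq, hD L, sum_mul, mul_sum]
    refine sum_congr rfl fun f _ => ?_
    have hperm := sum_perm_embedding_trans
      (fun g : Fin L.length ↪ Fin n => ∏ b, a (g b) ^ L.get b) f
    simp only [Fintype.card_fin, hlen] at hperm
    simp_rw [mul_pow, prod_mul_distrib]
    rw [← mul_sum, mul_left_comm, mul_left_comm (n.factorial : ℝ)]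
    exact congrArg _ hperm
  rw [← mul_sum, mul_left_comm, mul_div_assoc]
  congr 1
  rw [eq_div_iff hdesc, mul_assoc, mul_comm _ (n.descFactorial _ : ℝ), hmain, ← mul_assoc,
    one_div_mul_cancel hfac, one_mul]
end

section
/- For every integer n ≥ 2, the sixth null moment of Spearman's rho satisfies M_{ρ,6}(n) = 3 P_{ρ,6}(n) / (245 n³ (n−1)⁵ (n+1)³), where P_{ρ,6}(n) = 1225n⁸ − 4361n⁷ − 178n⁶ + 23818n⁵ − 22783n⁴ − 50081n³ + 54280n² + 44160n − 28800. -/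
open Finset Equiv

/-- The sum of `∏ j, x (f j) ^ e j` over all injective `k`-tuples `f` of indices. -/
noncomputable def injPowerSum {ι : Type*} [Fintype ι] {k : ℕ} (x : ι → ℝ) (e : Fin k → ℕ) : ℝ :=
  open Classical in ∑ f : Fin k ↪ ι, ∏ j, x (f j) ^ e j

section
variable {ι : Type*} [Fintype ι] {k : ℕ}

lemma injPowerSum_empty (x : ι → ℝ) : injPowerSum x ![] = 1 := by
  classical
  simp [injPowerSum]

lemma injPowerSum_vecCons (x : ι → ℝ) (m : ℕ) (e : Fin k → ℕ) :
    injPowerSum x (Matrix.vecCons m e) = (∑ i, x i ^ m) * injPowerSum x e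
      - ∑ j, injPowerSum x (Function.update e j (m + e j)) := by
  classical
  unfold injPowerSum
  rw [Finset.sum_comm, Finset.mul_sum, ← Finset.sum_sub_distrib,
    ← (Equiv.embeddingFinSucc k ι).symm.sum_comp, Fintype.sum_sigma]
  refine Finset.sum_congr rfl fun f _ => ?_
  have hupdate (j : Fin k) : ∏ l, x (f l) ^ Function.update e j (m + e j) l
      = x (f j) ^ m * ∏ l, x (f l) ^ e l := by
    rw [← Finset.mul_prod_erase univ _ (mem_univ j),
      ← Finset.mul_prod_erase univ (fun l => x (f l) ^ e l) (mem_univ j), Function.update_self,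
      pow_add, mul_assoc]
    congr 2
    refine Finset.prod_congr rfl fun l hl => ?_
    rw [Function.update_of_ne (ne_of_mem_erase hl)]
  have hcompl : ∑ i : {i // i ∉ Set.range f}, x i ^ m
      = ∑ i, x i ^ m - ∑ j, x (f j) ^ m := by
    rw [eq_sub_iff_add_eq', ← Fintype.sum_subtype_add_sum_subtype (· ∈ Set.range f)]
    congr 1
    convert (Equiv.ofInjective f f.injective).sum_comp fun i : Set.range f => x i ^ m
    rfl
  simp only [hupdate, Equiv.coe_embeddingFinSucc_symm, Fin.prod_univ_succ, Fin.cons_zero,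
    Fin.cons_succ, Matrix.cons_val_zero, Matrix.cons_val_succ]
  rw [← Finset.sum_mul, ← Finset.sum_mul, hcompl, sub_mul]

lemma descFactorial_mul_sum_perm (g : (Fin k ↪ ι) → ℝ) (f : Fin k ↪ ι) [DecidableEq ι] :
    ((Fintype.card ι).descFactorial k : ℝ) * ∑ π : Perm ι, g (f.trans π.toEmbedding)
      = (Fintype.card ι).factorial * ∑ t, g t := by
  have hconst (t : Fin k ↪ ι) : ∑ π : Perm ι, g (t.trans π.toEmbedding)
      = ∑ π : Perm ι, g (f.trans π.toEmbedding) := by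
    obtain ⟨σ, hσ⟩ : ∃ σ : Perm ι, ∀ j, σ (f j) = t j :=
      Equiv.Perm.exists_extending_pair f t f.injective t.injective
    refine Fintype.sum_equiv (Equiv.mulRight σ) _ _ fun π => congrArg g ?_
    ext j
    simp [hσ]
  have hcard : ((Fintype.card ι).descFactorial k : ℝ) = ∑ _t : Fin k ↪ ι, (1 : ℝ) := by
    simp [Fintype.card_embedding_eq]
  rw [hcard, Finset.sum_mul]
  simp only [one_mul]
  rw [← Finset.sum_congr rfl fun t _ => hconst t, Finset.sum_comm, ← Fintype.card_perm,
    ← nsmul_eq_mul, ← Finset.card_univ, ← Finset.sum_const]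
  refine Finset.sum_congr rfl fun π _ => ?_
  exact (Equiv.embeddingCongr (Equiv.refl _) π).sum_comp g

lemma descFactorial_mul_sum_perm_injPowerSum [DecidableEq ι] (x y : ι → ℝ) (e : Fin k → ℕ) :
    ((Fintype.card ι).descFactorial k : ℝ) *
        ∑ π : Perm ι, injPowerSum (fun i => x i * y (π i)) e
      = (Fintype.card ι).factorial * (injPowerSum x e * injPowerSum y e) := by
  classical
  unfold injPowerSum
  rw [Finset.sum_comm, Finset.mul_sum, Finset.sum_mul, Finset.mul_sum]
  refine Finset.sum_congr rfl fun f _ => ?_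
  have h := descFactorial_mul_sum_perm (fun t : Fin k ↪ ι => ∏ j, y (t j) ^ e j) f
  simp only [mul_pow, Finset.prod_mul_distrib]
  rw [← Finset.mul_sum, mul_left_comm, mul_left_comm (_ : ℝ) (∏ j, _)]
  exact congrArg _ h

lemma sum_perm_injPowerSum [DecidableEq ι] (x y : ι → ℝ) (e : Fin k → ℕ) {q : ℝ}
    (hq : injPowerSum y e = (Fintype.card ι).descFactorial k * q) :
    ∑ π : Perm ι, injPowerSum (fun i => x i * y (π i)) e
      = (Fintype.card ι).factorial * (injPowerSum x e * q) := by
  classical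
  rcases lt_or_ge (Fintype.card ι) k with hk | hk
  · have : IsEmpty (Fin k ↪ ι) := by
      rw [← Fintype.card_eq_zero_iff, Fintype.card_embedding_eq, Fintype.card_fin]
      exact Nat.descFactorial_of_lt hk
    simp [injPowerSum]
  · have h0 : ((Fintype.card ι).descFactorial k : ℝ) ≠ 0 := by
      exact_mod_cast (Nat.descFactorial_pos.2 hk).ne'
    apply mul_left_cancel₀ h0
    rw [descFactorial_mul_sum_perm_injPowerSum, hq]
    ring

lemma update_vecCons_zero {α : Type*} (a b : α) (v : Fin k → α) :
    Function.update (Matrix.vecCons a v) 0 b = Matrix.vecCons b v :=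
  Fin.update_cons_zero _ _ _

lemma update_vecCons_succ {α : Type*} (a b : α) (v : Fin k → α) (j : Fin k) :
    Function.update (Matrix.vecCons a v) j.succ b = Matrix.vecCons a (Function.update v j b) :=
  (Fin.cons_update _ _ _ _).symm

lemma sum_pow_six_eq_injPowerSum (x : ι → ℝ) :
    (∑ i, x i) ^ 6 = injPowerSum x ![6] + 6 * injPowerSum x ![5, 1]
      + 15 * injPowerSum x ![4, 2] + 10 * injPowerSum x ![3, 3]
      + 15 * injPowerSum x ![4, 1, 1] + 60 * injPowerSum x ![3, 2, 1]
      + 15 * injPowerSum x ![2, 2, 2] + 20 * injPowerSum x ![3, 1, 1, 1]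
      + 45 * injPowerSum x ![2, 2, 1, 1] + 15 * injPowerSum x ![2, 1, 1, 1, 1]
      + injPowerSum x ![1, 1, 1, 1, 1, 1] := by
  simp only [injPowerSum_vecCons, injPowerSum_empty, Fin.sum_univ_succ, Fin.sum_univ_zero,
    update_vecCons_zero, update_vecCons_succ, Matrix.cons_val_zero, Matrix.cons_val_succ,
    Nat.reduceAdd, pow_one]
  ring

end

lemma cast_descFactorial_succ (n k : ℕ) :
    (n.descFactorial (k + 1) : ℝ) = (n - k) * n.descFactorial k := by
  rw [Nat.descFactorial_succ, Nat.cast_mul]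
  rcases le_or_gt k n with h | h
  · rw [Nat.cast_sub h]
  · simp [Nat.descFactorial_of_lt h]

lemma sum_centered_rank_pow (n m : ℕ) (F : ℝ → ℝ) (hF : ∀ x, F (x + 1) - F x = x ^ m) :
    ∑ i : Fin n, ((i : ℝ) + 1 - ((n : ℝ) + 1) / 2) ^ m
      = F (((n : ℝ) + 1) / 2) - F ((1 - (n : ℝ)) / 2) := by
  rw [Fin.sum_univ_eq_sum_range fun i : ℕ => ((i : ℝ) + 1 - ((n : ℝ) + 1) / 2) ^ m]
  have h := Finset.sum_range_sub (fun i : ℕ => F ((i : ℝ) + 1 - ((n : ℝ) + 1) / 2)) n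
  convert h using 1
  · refine Finset.sum_congr rfl fun i _ => ?_
    rw [← hF]
    push_cast
    ring_nf
  · push_cast
    ring_nf

/-- The sum over all permutations of the sixth power of `∑ i, a i * a (π i)`, for the centered
ranks `a`. -/
lemma sum_perm_sum_centered_rank_pow_six (n : ℕ) (a : Fin n → ℝ)
    (ha : ∀ i, a i = (i : ℝ) + 1 - ((n : ℝ) + 1) / 2) :
    ∑ π : Perm (Fin n), (∑ i, a i * a (π i)) ^ 6 = n.factorial *
      (3 * n ^ 3 * (n - 1) * (n + 1) ^ 3 * (1225 * (n : ℝ) ^ 8 - 4361 * (n : ℝ) ^ 7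
        - 178 * (n : ℝ) ^ 6 + 23818 * (n : ℝ) ^ 5 - 22783 * (n : ℝ) ^ 4 - 50081 * (n : ℝ) ^ 3
        + 54280 * (n : ℝ) ^ 2 + 44160 * (n : ℝ) - 28800) / (245 * 12 ^ 6)) := by
  have hcard : Fintype.card (Fin n) = n := Fintype.card_fin n
  have p1 : ∑ i, a i ^ 1 = 0 := by
    simp only [ha]
    rw [sum_centered_rank_pow n 1 (fun x => x ^ 2 / 2 - x / 2)
      fun x => by ring]
    ring
  have p2 : ∑ i, a i ^ 2 = n * (n ^ 2 - 1) / 12 := by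
    simp only [ha]
    rw [sum_centered_rank_pow n 2 (fun x => x ^ 3 / 3 - x ^ 2 / 2 + x / 6)
      fun x => by ring]
    ring
  have p3 : ∑ i, a i ^ 3 = 0 := by
    simp only [ha]
    rw [sum_centered_rank_pow n 3 (fun x => x ^ 4 / 4 - x ^ 3 / 2 + x ^ 2 / 4)
      fun x => by ring]
    ring
  have p4 : ∑ i, a i ^ 4 = n * (n ^ 2 - 1) * (3 * n ^ 2 - 7) / 240 := by
    simp only [ha]
    rw [sum_centered_rank_pow n 4 (fun x => x ^ 5 / 5 - x ^ 4 / 2 + x ^ 3 / 3 - x / 30)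
      fun x => by ring]
    ring
  have p5 : ∑ i, a i ^ 5 = 0 := by
    simp only [ha]
    rw [sum_centered_rank_pow n 5 (fun x => x ^ 6 / 6 - x ^ 5 / 2 + 5 * x ^ 4 / 12 - x ^ 2 / 12)
      fun x => by ring]
    ring
  have p6 : ∑ i, a i ^ 6 = n * (n ^ 2 - 1) * (3 * n ^ 4 - 18 * n ^ 2 + 31) / 1344 := by
    simp only [ha]
    rw [sum_centered_rank_pow n 6 (fun x => x ^ 7 / 7 - x ^ 6 / 2 + x ^ 5 / 2 - x ^ 3 / 6 + x / 42)
      fun x => by ring]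
    ring
  obtain ⟨h6, h51, h42, h33, h411, h321, h222, h3111, h2211, h21111, h111111⟩ :
      injPowerSum a ![6]
        = (Fintype.card (Fin n)).descFactorial 1
          * ((n + 1) * (3 * n ^ 5 - 3 * n ^ 4 - 18 * n ^ 3 + 18 * n ^ 2 + 31 * n - 31) / 1344) ∧
      injPowerSum a ![5, 1]
        = (Fintype.card (Fin n)).descFactorial 2
          * ((n + 1) * (-3 * n ^ 4 + 18 * n ^ 2 - 31) / 1344) ∧
      injPowerSum a ![4, 2]
        = (Fintype.card (Fin n)).descFactorial 2
          * ((n + 1) * (21 * n ^ 5 - 45 * n ^ 4 - 70 * n ^ 3 + 270 * n ^ 2 + 49 * n - 465) / 20160) ∧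
      injPowerSum a ![3, 3]
        = (Fintype.card (Fin n)).descFactorial 2
          * ((n + 1) * (-3 * n ^ 4 + 18 * n ^ 2 - 31) / 1344) ∧
      injPowerSum a ![4, 1, 1]
        = (Fintype.card (Fin n)).descFactorial 3
          * ((n + 1) * (-21 * n ^ 4 + 48 * n ^ 3 + 166 * n ^ 2 - 208 * n - 465) / 20160) ∧
      injPowerSum a ![3, 2, 1]
        = (Fintype.card (Fin n)).descFactorial 3
          * ((n + 1) * (-21 * n ^ 4 + 48 * n ^ 3 + 166 * n ^ 2 - 208 * n - 465) / 20160) ∧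
      injPowerSum a ![2, 2, 2]
        = (Fintype.card (Fin n)).descFactorial 3
          * ((n + 1) * (35 * n ^ 5 - 119 * n ^ 4 - 38 * n ^ 3 + 554 * n ^ 2 - 477 * n - 1395) / 60480) ∧
      injPowerSum a ![3, 1, 1, 1]
        = (Fintype.card (Fin n)).descFactorial 4
          * ((n + 1) * (21 * n ^ 3 + 15 * n ^ 2 - 121 * n - 155) / 6720) ∧
      injPowerSum a ![2, 2, 1, 1]
        = (Fintype.card (Fin n)).descFactorial 4
          * ((n + 1) * (-7 * n ^ 4 + 28 * n ^ 3 + 34 * n ^ 2 - 208 * n - 279) / 12096) ∧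
      injPowerSum a ![2, 1, 1, 1, 1]
        = (Fintype.card (Fin n)).descFactorial 5
          * ((n + 1) * (35 * n ^ 3 - 63 * n ^ 2 - 467 * n - 465) / 20160) ∧
      injPowerSum a ![1, 1, 1, 1, 1, 1]
        = (Fintype.card (Fin n)).descFactorial 6
          * ((n + 1) * (-35 * n ^ 2 - 112 * n - 93) / 4032) := by
    refine ⟨?_, ?_, ?_, ?_, ?_, ?_, ?_, ?_, ?_, ?_, ?_⟩ <;>
    · simp only [injPowerSum_vecCons, injPowerSum_empty, Fin.sum_univ_succ, Fin.sum_univ_zero,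
        update_vecCons_zero, update_vecCons_succ, Matrix.cons_val_zero, Matrix.cons_val_succ,
        Nat.reduceAdd, p1, p2, p3, p4, p5, p6, hcard, cast_descFactorial_succ]
      simp only [Nat.descFactorial_zero]
      push_cast
      ring
  simp only [sum_pow_six_eq_injPowerSum, Finset.sum_add_distrib, ← Finset.mul_sum]
  rw [sum_perm_injPowerSum a a _ h6,
    sum_perm_injPowerSum a a _ h51,
    sum_perm_injPowerSum a a _ h42,
    sum_perm_injPowerSum a a _ h33,
    sum_perm_injPowerSum a a _ h411,
    sum_perm_injPowerSum a a _ h321,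
    sum_perm_injPowerSum a a _ h222,
    sum_perm_injPowerSum a a _ h3111,
    sum_perm_injPowerSum a a _ h2211,
    sum_perm_injPowerSum a a _ h21111,
    sum_perm_injPowerSum a a _ h111111,
    h6, h51, h42, h33, h411, h321, h222, h3111, h2211, h21111, h111111]
  simp only [hcard, cast_descFactorial_succ]
  simp only [Nat.descFactorial_zero]
  push_cast
  ring

/-- Sixth null moment of Spearman's rho. -/
theorem stmt5 (n : ℕ) (hn : 2 ≤ n)
    (a : Fin n → ℝ) (ha : ∀ i, a i = (i : ℝ) + 1 - ((n : ℝ) + 1) / 2)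
    (ρ : Perm (Fin n) → ℝ)
    (hρ : ∀ π, ρ π = (12 / ((n : ℝ) * ((n : ℝ) ^ 2 - 1))) * ∑ i, a i * a (π i))
    (M : ℕ → ℝ)
    (hM : ∀ r, M r = (1 / (n.factorial : ℝ)) * ∑ π : Perm (Fin n), (ρ π) ^ r) :
    M 6 = 3 * (1225 * (n : ℝ) ^ 8 - 4361 * (n : ℝ) ^ 7 - 178 * (n : ℝ) ^ 6
        + 23818 * (n : ℝ) ^ 5 - 22783 * (n : ℝ) ^ 4 - 50081 * (n : ℝ) ^ 3
        + 54280 * (n : ℝ) ^ 2 + 44160 * (n : ℝ) - 28800) /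
      (245 * (n : ℝ) ^ 3 * ((n : ℝ) - 1) ^ 5 * ((n : ℝ) + 1) ^ 3) := by
  have h2 : (2 : ℝ) ≤ n := by exact_mod_cast hn
  have hn0 : (n : ℝ) ≠ 0 := by positivity
  have hsub : (n : ℝ) - 1 ≠ 0 := by linarith
  have hadd : (n : ℝ) + 1 ≠ 0 := by positivity
  have hfac : (n.factorial : ℝ) ≠ 0 := by positivity
  have hsq : (n : ℝ) ^ 2 - 1 = (n - 1) * (n + 1) := by ring
  simp only [hM, hρ, mul_pow]
  rw [← Finset.mul_sum, sum_perm_sum_centered_rank_pow_six n a ha, hsq]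
  field_simp
end

section
/- For every integer n ≥ 2, the null variance of the sixth power of Spearman's rho satisfies M_{ρ,12}(n) − M_{ρ,6}(n)² = 18(n−2) Q_{ρ,6}(n) / (2789661875 n⁹ (n−1)¹¹ (n+1)⁹), where Q_{ρ,6}(n) = 1576158959375n²² − 26956502698125n²¹ + 204016193881500n²⁰ − 656132617822682n¹⁹ − 1171932384888603n¹⁸ + 16913917053629829n¹⁷ − 33663135573263722n¹⁶ − 143066811467638476n¹⁵ + 610987613264235129n¹⁴ + 596842447834386253n¹³ − 5189139972464602944n¹² − 1409441833203864570n¹¹ + 27750786105920376371n¹⁰ + 4444828679768649627n⁹ − 95698023681505100946n⁸ − 19996738740525207104n⁷ + 206938856876542180608n⁶ + 34634552355461373696n⁵ − 313861911687028044288n⁴ − 56314087053512122368n³ + 270499002102369976320n² + 37528151745373470720n − 101439305560276992000. -/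
open Finset Equiv
namespace SpearmanMoment

variable {ι : Type*} [DecidableEq ι]

/-- The sum of `∏ j, b (i j) ^ L j` over the tuples `i` of distinct elements of `s`. -/
def distinctSum (b : ι → ℝ) : List ℕ → Finset ι → ℝ
  | [], _ => 1
  | l :: L, s => ∑ i ∈ s, b i ^ l * distinctSum b L (s.erase i)

theorem distinctSum_cons (b : ι → ℝ) (l : ℕ) (L : List ℕ) (s : Finset ι) :
    distinctSum b (l :: L) s = ∑ i ∈ s, b i ^ l * distinctSum b L (s.erase i) := rfl

theorem distinctSum_swap (b : ι → ℝ) (x y : ℕ) (L : List ℕ) (s : Finset ι) :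
    distinctSum b (x :: y :: L) s = distinctSum b (y :: x :: L) s := by
  simp only [distinctSum, mul_sum]
  rw [sum_comm' (s' := fun j => s.erase j) (t' := s)
    (by intro i j; simp only [mem_erase]; tauto)]
  refine sum_congr rfl fun i _ => sum_congr rfl fun j _ => ?_
  rw [erase_right_comm]
  ring

theorem distinctSum_perm (b : ι → ℝ) {L M : List ℕ} (h : L.Perm M) (s : Finset ι) :
    distinctSum b L s = distinctSum b M s := by
  induction h generalizing s with
  | nil => rfl
  | cons x _ ih => simp only [distinctSum, ih]
  | swap x y L => exact distinctSum_swap b y x L s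
  | trans _ _ ih₁ ih₂ => rw [ih₁, ih₂]

theorem distinctSum_eq_zero (b : ι → ℝ) (L : List ℕ) (s : Finset ι) (h : #s < L.length) :
    distinctSum b L s = 0 := by
  induction L generalizing s with
  | nil => simp at h
  | cons l L ih =>
    refine sum_eq_zero fun i hi => ?_
    rw [ih, mul_zero]
    rw [card_erase_of_mem hi]
    have := card_pos.mpr ⟨i, hi⟩
    simp only [List.length_cons] at h
    omega

/-- The lists obtained by adding `x` to one entry of a list, kept sorted. -/
def merges (x : ℕ) : List ℕ → List (List ℕ)
  | [] => []
  | l :: L => L.orderedInsert (· ≤ ·) (l + x) :: (merges x L).map (l :: ·)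

theorem length_of_mem_merges {x : ℕ} {L M : List ℕ} (h : M ∈ merges x L) :
    M.length = L.length := by
  induction L generalizing M with
  | nil => simp [merges] at h
  | cons l L ih =>
    simp only [merges, List.mem_cons, List.mem_map] at h
    rcases h with rfl | ⟨N, hN, rfl⟩
    · simp [List.orderedInsert_length]
    · simp [ih hN]

theorem powerSum_mul_distinctSum (b : ι → ℝ) (x : ℕ) (L : List ℕ) (s : Finset ι) :
    (∑ i ∈ s, b i ^ x) * distinctSum b L s =
      distinctSum b (x :: L) s + ((merges x L).map fun M => distinctSum b M s).sum := by
  induction L generalizing s with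
  | nil => simp [distinctSum, merges]
  | cons l L ih =>
    have hmap : ((merges x L).map fun M => distinctSum b (l :: M) s).sum =
        ∑ i ∈ s, b i ^ l * ((merges x L).map fun M => distinctSum b M (s.erase i)).sum := by
      induction merges x L with
      | nil => simp
      | cons M Ms ihM =>
        simp only [List.map_cons, List.sum_cons, mul_add, sum_add_distrib, ihM]
        rfl
    rw [distinctSum_swap, merges, List.map_cons, List.sum_cons, List.map_map,
      distinctSum_perm b (List.perm_orderedInsert _ _ _)]
    simp only [Function.comp_def]
    rw [hmap]
    rw [distinctSum_cons b l, distinctSum_cons b l, distinctSum_cons b (l + x)]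
    rw [mul_sum, ← sum_add_distrib, ← sum_add_distrib]
    refine sum_congr rfl fun i hi => ?_
    rw [← add_sum_erase s (fun j => b j ^ x) hi]
    linear_combination b i ^ l * ih (s.erase i)

theorem distinctSum_eq_sum_injective [Fintype ι] (b : ι → ℝ) (L : List ℕ) (s : Finset ι) :
    distinctSum b L s = ∑ f : Fin L.length → ι,
      open Classical in
      if Function.Injective f ∧ ∀ j, f j ∈ s then ∏ j, b (f j) ^ L.get j else 0 := by
  classical
  induction L generalizing s with
  | nil => simp [distinctSum, Function.injective_of_subsingleton]
  | cons l L ih =>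
    have hcons : ∀ (i : ι) (f : Fin L.length → ι),
        (Function.Injective (Fin.cons i f : Fin (L.length + 1) → ι) ∧
          ∀ j, (Fin.cons i f : Fin (L.length + 1) → ι) j ∈ s) ↔
        i ∈ s ∧ Function.Injective f ∧ ∀ j, f j ∈ s.erase i := by
      intro i f
      simp only [Fin.cons_injective_iff, Fin.forall_fin_succ, Fin.cons_zero, Fin.cons_succ,
        mem_erase, Set.mem_range, not_exists]
      grind
    refine Eq.trans ?_ ((Fin.consEquiv fun _ : Fin (L.length + 1) => ι).sum_comp _)
    rw [Fintype.sum_prod_type, distinctSum_cons, ← sum_subset (subset_univ s)]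
    · refine sum_congr rfl fun i hi => ?_
      rw [ih, mul_sum]
      refine sum_congr rfl fun f _ => ?_
      rw [mul_ite, mul_zero]
      refine if_congr ?_ ?_ rfl
      · exact ((hcons i f).trans (and_iff_right hi)).symm
      · exact (Fin.prod_univ_succ fun j : Fin (L.length + 1) =>
          b ((Fin.cons i f : Fin (L.length + 1) → ι) j) ^ (l :: L).get j).symm
    · exact fun i _ hi => sum_eq_zero fun f _ => if_neg fun h => hi ((hcons i f).mp h).1

theorem distinctSum_univ [Fintype ι] (b : ι → ℝ) (L : List ℕ) :
    distinctSum b L univ = ∑ f : Fin L.length ↪ ι, ∏ j, b (f j) ^ L.get j := by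
  classical
  rw [distinctSum_eq_sum_injective, ← (subtypeInjectiveEquivEmbedding _ _).sum_comp,
    ← sum_filter]
  simp only [mem_univ, implies_true, and_true]
  exact sum_subtype _ (by simp) _

theorem sum_perm_distinctSum [Fintype ι] (a : ι → ℝ) (L : List ℕ) :
    ((Fintype.card ι).descFactorial L.length : ℝ) *
        ∑ π : Perm ι, distinctSum (fun i => a i * a (π i)) L univ =
      (Fintype.card ι).factorial * distinctSum a L univ ^ 2 := by
  set W : (Fin L.length ↪ ι) → ℝ := fun f => ∏ j, a (f j) ^ L.get j with hW
  set C : (Fin L.length ↪ ι) → ℝ := fun f => ∑ π : Perm ι, W (f.trans π.toEmbedding) with hC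
  have hconst : ∀ f g, C f = C g := by
    intro f g
    have := Perm.isMultiplyPretransitive ι L.length
    obtain ⟨σ, hσ⟩ := MulAction.exists_smul_eq (Perm ι) f g
    rw [hC]
    simp only
    rw [← Equiv.sum_comp (Equiv.mulRight σ), ← hσ]
    rfl
  have hsum : ∑ g, C g = (Fintype.card ι).factorial * ∑ g, W g := by
    rw [hC, sum_comm, ← Fintype.card_perm, ← nsmul_eq_mul, ← card_univ, ← sum_const]
    exact sum_congr rfl fun π _ =>
      (Equiv.embeddingCongr (Equiv.refl _) π).sum_comp W
  have hexp : ∑ π : Perm ι, distinctSum (fun i => a i * a (π i)) L univ = ∑ f, W f * C f := by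
    simp only [distinctSum_univ, mul_pow, prod_mul_distrib, hC, mul_sum]
    rw [sum_comm]
    rfl
  have hcard : ((Fintype.card ι).descFactorial L.length : ℝ) =
      ∑ _g : Fin L.length ↪ ι, (1 : ℝ) := by
    simp [Fintype.card_embedding_eq]
  rw [hexp, hcard, sum_mul_sum]
  simp only [one_mul]
  rw [sum_comm]
  calc ∑ f, ∑ g, W f * C f = ∑ f, ∑ g, W f * C g :=
        sum_congr rfl fun f _ => sum_congr rfl fun g _ => by rw [hconst f g]
    _ = _ := by
      rw [← sum_mul_sum, hsum, distinctSum_univ]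
      ring

/-! ### Forced evaluation

Each of these functions hands its argument to a continuation after evaluating it, which keeps kernel
computations from duplicating unevaluated terms. -/

def forceNat {α : Type} (n : ℕ) (k : ℕ → α) : α :=
  match n with
  | 0 => k 0
  | m + 1 => k (Nat.succ m)

def forceInt {α : Type} (z : ℤ) (k : ℤ → α) : α :=
  match z with
  | .ofNat n => forceNat n fun m => k (.ofNat m)
  | .negSucc n => forceNat n fun m => k (.negSucc m)

def forceParts {α : Type} : List ℕ → (List ℕ → α) → α
  | [], k => k []
  | n :: l, k => forceNat n fun m => forceParts l fun l' => k (m :: l')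

def forceComb {α : Type} : List (ℕ × List ℕ) → (List (ℕ × List ℕ) → α) → α
  | [], k => k []
  | (c, L) :: C, k => forceNat c fun d => forceParts L fun M => forceComb C fun D =>
      k ((d, M) :: D)

/-- Evaluate a coefficient list and drop its trailing zeros. -/
def forcePoly {α : Type} : List ℤ → (List ℤ → α) → α
  | [], k => k []
  | c :: p, k => forcePoly p fun p' => forceInt c fun c' =>
      match p' with
      | [] => if c' = 0 then k [] else k [c']
      | d :: q => k (c' :: d :: q)

theorem forceNat_eq {α : Type} (n : ℕ) (k : ℕ → α) : forceNat n k = k n := by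
  cases n <;> rfl

theorem forceInt_eq {α : Type} (z : ℤ) (k : ℤ → α) : forceInt z k = k z := by
  cases z <;> simp [forceInt, forceNat_eq]

theorem forceParts_eq {α : Type} (L : List ℕ) (k : List ℕ → α) : forceParts L k = k L := by
  induction L generalizing k with
  | nil => rfl
  | cons n L ih => simp [forceParts, forceNat_eq, ih]

theorem forceComb_eq {α : Type} (C : List (ℕ × List ℕ)) (k : List (ℕ × List ℕ) → α) :
    forceComb C k = k C := by
  induction C generalizing k with
  | nil => rfl
  | cons t C ih => simp [forceComb, forceNat_eq, forceParts_eq, ih]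

/-! ### Integer polynomials as coefficient lists -/

def evalP (x : ℝ) : List ℤ → ℝ
  | [] => 0
  | c :: p => c + x * evalP x p

def addP : List ℤ → List ℤ → List ℤ
  | [], q => q
  | p, [] => p
  | c :: p, d :: q => (c + d) :: addP p q

def scaleP (c : ℤ) (p : List ℤ) : List ℤ := p.map (c * ·)

def mulP : List ℤ → List ℤ → List ℤ
  | [], _ => []
  | c :: p, q => addP (scaleP c q) (0 :: mulP p q)

/-- Remainder and quotient of the division by `X - a`. -/
def divP (a : ℤ) : List ℤ → ℤ × List ℤ
  | [] => (0, [])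
  | c :: p =>
    match divP a p with
    | (r, q) => forceInt (c + a * r) fun d => (d, r :: q)

/-- The product of `p` with the falling factorial `X (X - 1) ⋯ (X - k + 1)`. -/
def fallP (p : List ℤ) : ℕ → List ℤ
  | 0 => p
  | k + 1 => forcePoly (fallP p k) fun q => addP (0 :: q) (scaleP (-k) q)

theorem forcePoly_eq {α : Type} (p : List ℤ) (k : List ℤ → α) :
    ∃ q, forcePoly p k = k q ∧ ∀ x, evalP x q = evalP x p := by
  induction p generalizing k with
  | nil => exact ⟨[], rfl, fun _ => rfl⟩
  | cons c p ih =>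
    simp only [forcePoly, forceInt_eq]
    obtain ⟨q, hq, he⟩ := ih fun p' =>
      match p' with
      | [] => if c = 0 then k [] else k [c]
      | d :: q => k (c :: d :: q)
    rw [hq]
    cases q with
    | nil =>
      by_cases hc : c = 0
      · exact ⟨[], by simp [hc], fun x => by simp [evalP, ← he, hc]⟩
      · exact ⟨[c], by simp [hc], fun x => by simp [evalP, ← he]⟩
    | cons d q => exact ⟨c :: d :: q, rfl, fun x => by rw [evalP, he, evalP]⟩

theorem evalP_addP (x : ℝ) (p q : List ℤ) : evalP x (addP p q) = evalP x p + evalP x q := by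
  induction p, q using addP.induct with
  | case1 q => simp [addP, evalP]
  | case2 p hp => cases p <;> simp [addP, evalP]
  | case3 c p d q ih => simp only [addP, evalP, ih]; push_cast; ring

theorem evalP_scaleP (x : ℝ) (c : ℤ) (p : List ℤ) : evalP x (scaleP c p) = c * evalP x p := by
  induction p with
  | nil => simp [scaleP, evalP]
  | cons d p ih =>
    simp only [scaleP, List.map_cons, evalP] at ih ⊢
    rw [ih]; push_cast; ring

theorem evalP_mulP (x : ℝ) (p q : List ℤ) : evalP x (mulP p q) = evalP x p * evalP x q := by
  induction p with
  | nil => simp [mulP, evalP]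
  | cons c p ih => simp only [mulP, evalP_addP, evalP_scaleP, evalP, ih]; push_cast; ring

theorem evalP_divP (x : ℝ) (a : ℤ) (p : List ℤ) :
    evalP x p = (divP a p).1 + (x - a) * evalP x (divP a p).2 := by
  induction p with
  | nil => simp [divP, evalP]
  | cons c p ih => simp only [divP, forceInt_eq, evalP, ih]; push_cast; ring

theorem evalP_fallP (n : ℕ) (p : List ℤ) (k : ℕ) :
    evalP n (fallP p k) = n.descFactorial k * evalP n p := by
  induction k with
  | zero => simp [fallP]
  | succ k ih =>
    obtain ⟨q, hq, he⟩ := forcePoly_eq (fallP p k) fun q => addP (0 :: q) (scaleP (-k) q)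
    simp only [fallP, hq, evalP_addP, evalP_scaleP, evalP, he, ih, Nat.descFactorial_succ]
    rcases le_or_gt k n with h | h
    · push_cast [Nat.cast_sub h]; ring
    · simp [Nat.descFactorial_of_lt h]

/-! ### Expansion of powers of a sum -/

def eqParts : List ℕ → List ℕ → Bool
  | [], [] => true
  | a :: L, b :: M => Nat.beq a b && eqParts L M
  | _, _ => false

theorem eq_of_eqParts {L M : List ℕ} (h : eqParts L M = true) : L = M := by
  induction L, M using eqParts.induct with
  | case1 => rfl
  | case2 a L b M ih =>
    simp only [eqParts, Bool.and_eq_true, Nat.beq_eq] at h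
    rw [h.1, ih h.2]
  | case3 L M h₁ h₂ => simp [eqParts] at h

def addTerm (c : ℕ) (L : List ℕ) : List (ℕ × List ℕ) → List (ℕ × List ℕ)
  | [] => [(c, L)]
  | (d, M) :: C => bif eqParts L M then (d + c, M) :: C else (d, M) :: addTerm c L C

def addTerms (c : ℕ) (Ls : List (List ℕ)) (C : List (ℕ × List ℕ)) : List (ℕ × List ℕ) :=
  Ls.foldr (fun L D => forceParts L fun L' => addTerm c L' D) C

def stepComb (C : List (ℕ × List ℕ)) : List (ℕ × List ℕ) :=
  C.foldr (fun t D => addTerms t.1 ((1 :: t.2) :: merges 1 t.2) D) []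

/-- The expansion of the `r`-th power of a sum into sums over distinct indices. -/
def powComb : ℕ → List (ℕ × List ℕ)
  | 0 => [(1, [])]
  | r + 1 => forceComb (stepComb (powComb r)) id

def combSum (F : List ℕ → ℝ) (C : List (ℕ × List ℕ)) : ℝ :=
  (C.map fun t => t.1 * F t.2).sum

theorem combSum_addTerm (F : List ℕ → ℝ) (c : ℕ) (L : List ℕ) (C : List (ℕ × List ℕ)) :
    combSum F (addTerm c L C) = c * F L + combSum F C := by
  induction C with
  | nil => simp [addTerm, combSum]
  | cons t C ih =>
    obtain ⟨d, M⟩ := t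
    rw [addTerm]
    cases h : eqParts L M with
    | true =>
      simp only [cond_true, combSum, List.map_cons, List.sum_cons, eq_of_eqParts h]
      push_cast; ring
    | false =>
      simp only [combSum] at ih
      simp only [cond_false, combSum, List.map_cons, List.sum_cons, ih]
      ring

theorem combSum_addTerms (F : List ℕ → ℝ) (c : ℕ) (Ls : List (List ℕ)) (C : List (ℕ × List ℕ)) :
    combSum F (addTerms c Ls C) = c * (Ls.map F).sum + combSum F C := by
  induction Ls with
  | nil => simp [addTerms]
  | cons L Ls ih =>
    simp only [addTerms, forceParts_eq] at ih
    simp only [addTerms, List.foldr_cons, forceParts_eq, combSum_addTerm, ih, List.map_cons,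
      List.sum_cons]
    ring

theorem combSum_stepComb (b : ι → ℝ) (s : Finset ι) (C : List (ℕ × List ℕ)) :
    combSum (distinctSum b · s) (stepComb C) = (∑ i ∈ s, b i) * combSum (distinctSum b · s) C := by
  induction C with
  | nil => simp [stepComb, combSum]
  | cons t C ih =>
    have h := powerSum_mul_distinctSum b 1 t.2 s
    simp only [pow_one] at h
    simp only [stepComb] at ih
    simp only [stepComb, List.foldr_cons, combSum_addTerms, ih, List.map_cons, List.sum_cons, ← h]
    simp only [combSum, List.map_cons, List.sum_cons]
    ring

theorem sum_pow_eq_combSum (b : ι → ℝ) (s : Finset ι) (r : ℕ) :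
    (∑ i ∈ s, b i) ^ r = combSum (distinctSum b · s) (powComb r) := by
  induction r with
  | zero => simp [powComb, combSum, distinctSum]
  | succ r ih => rw [pow_succ', powComb, forceComb_eq, id, combSum_stepComb, ← ih]

/-! ### Means over distinct indices -/

/-- The power sum of the multiples by `√15015` of `1 - n, 3 - n, …, n - 1`, as a polynomial in `n`. -/
def powerSumP : ℕ → Option (List ℤ)
  | 2 => some [0, -5005, 0, 5005]
  | 4 => some [0, 105210105, 0, -150300150, 0, 45090045]
  | 6 => some [0, -4997104237125, 0, 7898648632875, 0, -3385135128375, 0, 483590732625]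
  | 8 => some [0, 430342073464928625, 0, -700294187790697500, 0, 332074985823330750, 0,
      -67770405270067500, 0, 5647533772505625]
  | 10 => some [0, -59088592789938915328125, 0, 96923793496138549565625, 0,
      -47317127533547953331250, 0, 10684512668865666881250, 0, -1271965793912579390625, 0,
      69379952395231603125]
  | 12 => some [0, 11874497977822151487506315625, 0, -19518734856300521900339531250, 0,
      9605051011673834123403871875, 0, -2232895248308127917701687500, 0,
      294117922492199645073609375, 0, -22918279674716855460281250, 0, 881472295181417517703125]
  | x => if x % 2 = 1 then some [] else none

def lookupP (L : List ℕ) : List (List ℕ × List ℤ) → Option (List ℤ)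
  | [] => none
  | (M, P) :: t => bif eqParts L M then some P else lookupP L t

def sumLookup (t : List (List ℕ × List ℤ)) : List (List ℕ) → Option (List ℤ)
  | [] => some []
  | M :: Ms => (forceParts M fun M' => lookupP M' t).bind fun P =>
      (sumLookup t Ms).map fun R => addP P R

def headTerm (t : List (List ℕ × List ℤ)) (x : ℕ) (L : List ℕ) : Option (List ℤ) :=
  (powerSumP x).bind fun p =>
    match p with
    | [] => some []
    | c :: p => (lookupP L t).map fun P => mulP (c :: p) P

/-- Add to a table of means over distinct indices the mean with exponents `x :: L`. -/
def extend (t : List (List ℕ × List ℤ)) : List ℕ → Option (List (List ℕ × List ℤ))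
  | [] => some (([], [1]) :: t)
  | x :: L => (headTerm t x L).bind fun A => (sumLookup t (merges x L)).bind fun B =>
      forcePoly (addP A (scaleP (-1) B)) fun N =>
        if (divP L.length N).1 = 0 then
          forcePoly (divP L.length N).2 fun P => some ((x :: L, P) :: t)
        else none

def extendAll (t : List (List ℕ × List ℤ)) : List (List ℕ) → Option (List (List ℕ × List ℤ))
  | [] => some t
  | L :: Ls => (forceParts L fun M => extend t M).bind fun u => extendAll u Ls

/-- The partitions of `r`, shorter ones first. -/
def partitions (r : ℕ) : List (List ℕ) :=
  forceComb (powComb r) fun C =>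
    (List.range (r + 1)).flatMap fun k => (C.map (·.2)).filter (·.length == k)

def meanTable : Option (List (List ℕ × List ℤ)) :=
  extendAll [] ([0, 2, 4, 6, 8, 10, 12].flatMap partitions)

def addMoments (t : List (List ℕ × List ℤ)) : List (ℕ × List ℕ) → List ℤ → Option (List ℤ)
  | [], A => some A
  | (c, L) :: C, A => (lookupP L t).bind fun P =>
      forcePoly (addP A (fallP (scaleP c (mulP P P)) L.length)) fun B => addMoments t C B

/-- The sixth and the twelfth moment. -/
def moments : Option (List ℤ × List ℤ) :=
  meanTable.bind fun t => (addMoments t (powComb 6) []).bind fun A =>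
    (addMoments t (powComb 12) []).map fun B => (A, B)

theorem lookupP_mem {L : List ℕ} {t : List (List ℕ × List ℤ)} {P : List ℤ}
    (h : lookupP L t = some P) : (L, P) ∈ t := by
  induction t with
  | nil => simp [lookupP] at h
  | cons u t ih =>
    obtain ⟨M, Q⟩ := u
    rw [lookupP] at h
    cases hLM : eqParts L M with
    | true =>
      rw [hLM, cond_true, Option.some.injEq] at h
      simp [eq_of_eqParts hLM, h]
    | false =>
      rw [hLM, cond_false] at h
      exact List.mem_cons_of_mem _ (ih h)

variable {n : ℕ}

/-- The entries of `t` are the means of the products of powers of `b` over distinct indices. -/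
def IsMeanTable (b : Fin n → ℝ) (t : List (List ℕ × List ℤ)) : Prop :=
  ∀ u ∈ t, distinctSum b u.1 univ = n.descFactorial u.1.length * evalP n u.2

def HasPowerSums (b : Fin n → ℝ) : Prop :=
  ∀ x p, powerSumP x = some p → ∑ i, b i ^ x = evalP n p

theorem IsMeanTable.sumLookup {b : Fin n → ℝ} {t : List (List ℕ × List ℤ)} (ht : IsMeanTable b t)
    {k : ℕ} {Ms : List (List ℕ)} (hMs : ∀ M ∈ Ms, M.length = k) {R : List ℤ}
    (hR : sumLookup t Ms = some R) :
    (Ms.map fun M => distinctSum b M univ).sum = n.descFactorial k * evalP n R := by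
  induction Ms generalizing R with
  | nil =>
    simp only [SpearmanMoment.sumLookup, Option.some.injEq] at hR
    simp [← hR, evalP]
  | cons M Ms ih =>
    simp only [SpearmanMoment.sumLookup, forceParts_eq, Option.bind_eq_some_iff,
      Option.map_eq_some_iff] at hR
    obtain ⟨P, hP, Q, hQ, rfl⟩ := hR
    have hM := ht _ (lookupP_mem hP)
    simp only [hMs M List.mem_cons_self] at hM
    rw [List.map_cons, List.sum_cons, ih (fun N hN => hMs N (List.mem_cons_of_mem _ hN)) hQ, hM,
      evalP_addP]
    ring

theorem IsMeanTable.headTerm {b : Fin n → ℝ} {t : List (List ℕ × List ℤ)} (ht : IsMeanTable b t)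
    (hb : HasPowerSums b) {x : ℕ} {L : List ℕ} {A : List ℤ} (hA : headTerm t x L = some A) :
    (∑ i, b i ^ x) * distinctSum b L univ = n.descFactorial L.length * evalP n A := by
  simp only [SpearmanMoment.headTerm, Option.bind_eq_some_iff] at hA
  obtain ⟨p, hp, hA⟩ := hA
  rw [hb x p hp]
  cases p with
  | nil =>
    simp only [Option.some.injEq] at hA
    simp [← hA, evalP]
  | cons c p =>
    simp only [Option.map_eq_some_iff] at hA
    obtain ⟨P, hP, rfl⟩ := hA
    rw [ht _ (lookupP_mem hP), evalP_mulP]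
    ring

theorem IsMeanTable.extend {b : Fin n → ℝ} {t u : List (List ℕ × List ℤ)} (ht : IsMeanTable b t)
    (hb : HasPowerSums b) {L : List ℕ} (hu : extend t L = some u) : IsMeanTable b u := by
  cases L with
  | nil =>
    simp only [SpearmanMoment.extend, Option.some.injEq] at hu
    subst hu
    intro v hv
    rcases List.mem_cons.mp hv with rfl | hv
    · simp [distinctSum, evalP]
    · exact ht v hv
  | cons x L =>
    simp only [SpearmanMoment.extend, Option.bind_eq_some_iff] at hu
    obtain ⟨A, hA, B, hB, hu⟩ := hu
    obtain ⟨N, hN, heN⟩ := forcePoly_eq (addP A (scaleP (-1) B)) fun N =>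
        if (divP L.length N).1 = 0 then
          forcePoly (divP L.length N).2 fun P => some ((x :: L, P) :: t)
        else none
    rw [hN] at hu
    split_ifs at hu with hrem
    obtain ⟨P, hP, heP⟩ := forcePoly_eq (divP L.length N).2 fun P => some ((x :: L, P) :: t)
    rw [hP, Option.some.injEq] at hu
    subst hu
    intro v hv
    rcases List.mem_cons.mp hv with rfl | hv
    swap
    · exact ht v hv
    rcases lt_or_ge L.length n with hlt | hge
    · have hdiv := evalP_divP (n : ℝ) L.length N
      rw [heN, evalP_addP, evalP_scaleP, hrem, ← heP] at hdiv
      have hmul := powerSum_mul_distinctSum b x L univ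
      rw [ht.headTerm hb hA, ht.sumLookup (fun M hM => length_of_mem_merges hM) hB] at hmul
      simp only [List.length_cons, Nat.descFactorial_succ]
      push_cast [Nat.cast_sub hlt.le] at hdiv ⊢
      linear_combination (n.descFactorial L.length : ℝ) * hdiv - hmul
    · rw [distinctSum_eq_zero, List.length_cons, Nat.descFactorial_of_lt (by omega)]
      · simp
      · rw [card_univ, Fintype.card_fin, List.length_cons]
        omega

theorem IsMeanTable.extendAll {b : Fin n → ℝ} {t u : List (List ℕ × List ℤ)} (ht : IsMeanTable b t)
    (hb : HasPowerSums b) {Ls : List (List ℕ)} (hu : extendAll t Ls = some u) :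
    IsMeanTable b u := by
  induction Ls generalizing t with
  | nil =>
    simp only [SpearmanMoment.extendAll, Option.some.injEq] at hu
    rwa [← hu]
  | cons L Ls ih =>
    simp only [SpearmanMoment.extendAll, forceParts_eq, Option.bind_eq_some_iff] at hu
    obtain ⟨v, hv, hu⟩ := hu
    exact ih (ht.extend hb hv) hu

/-! ### Moments -/

theorem IsMeanTable.sum_perm {b : Fin n → ℝ} {t : List (List ℕ × List ℤ)} (ht : IsMeanTable b t)
    {L : List ℕ} {P : List ℤ} (hP : (L, P) ∈ t) :
    ∑ π : Perm (Fin n), distinctSum (fun i => b i * b (π i)) L univ =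
      n.factorial * (n.descFactorial L.length * evalP n P ^ 2) := by
  rcases le_or_gt L.length n with hle | hlt
  · have h := sum_perm_distinctSum b L
    rw [ht _ hP, Fintype.card_fin] at h
    have h0 : (n.descFactorial L.length : ℝ) ≠ 0 := by
      exact_mod_cast (Nat.descFactorial_pos.mpr hle).ne'
    refine mul_left_cancel₀ h0 (h.trans ?_)
    ring
  · rw [Nat.descFactorial_of_lt hlt]
    simp only [Nat.cast_zero, zero_mul, mul_zero]
    exact sum_eq_zero fun π _ => distinctSum_eq_zero _ _ _ (by simpa using hlt)

theorem IsMeanTable.addMoments {b : Fin n → ℝ} {t : List (List ℕ × List ℤ)} (ht : IsMeanTable b t)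
    {C : List (ℕ × List ℕ)} {A R : List ℤ} (hR : addMoments t C A = some R) :
    ∑ π : Perm (Fin n), combSum (distinctSum (fun i => b i * b (π i)) · univ) C =
      n.factorial * (evalP n R - evalP n A) := by
  induction C generalizing A with
  | nil =>
    simp only [SpearmanMoment.addMoments, Option.some.injEq] at hR
    simp [combSum, hR]
  | cons u C ih =>
    obtain ⟨c, L⟩ := u
    simp only [SpearmanMoment.addMoments, Option.bind_eq_some_iff] at hR
    obtain ⟨P, hP, hR⟩ := hR
    obtain ⟨A', hA', he⟩ := forcePoly_eq (addP A (fallP (scaleP c (mulP P P)) L.length))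
      fun A' => SpearmanMoment.addMoments t C A'
    rw [hA'] at hR
    have h := ih hR
    rw [he, evalP_addP, evalP_fallP, evalP_scaleP, evalP_mulP] at h
    simp only [combSum] at h
    simp only [combSum, List.map_cons, List.sum_cons, sum_add_distrib, ← mul_sum, h,
      ht.sum_perm (lookupP_mem hP)]
    push_cast
    ring

theorem sum_perm_pow_of_moments {b : Fin n → ℝ} (hb : HasPowerSums b) {A B : List ℤ}
    (h : moments = some (A, B)) :
    ∑ π : Perm (Fin n), (∑ i, b i * b (π i)) ^ 6 = n.factorial * evalP n A ∧
    ∑ π : Perm (Fin n), (∑ i, b i * b (π i)) ^ 12 = n.factorial * evalP n B := by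
  simp only [moments, Option.bind_eq_some_iff, Option.map_eq_some_iff, Prod.mk.injEq] at h
  obtain ⟨t, ht, A', hA, B', hB, rfl, rfl⟩ := h
  have hm : IsMeanTable b t := IsMeanTable.extendAll (t := []) (by simp [IsMeanTable]) hb ht
  simp only [sum_pow_eq_combSum, hm.addMoments hA, hm.addMoments hB, evalP, sub_zero, and_self]

/-- `243855360` times the sixth null moment of `∑ i, a i * a (π i)`. -/
def sixthMomentP : List ℤ :=
  [0, 0, 0, 28800, 13440, -142600, -116079, 182465, 174468, -93340, -90930, 32350, 21012,
    -8900, -1911, 1225]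

/-- `131602674572328960000` times the twelfth null moment of `∑ i, a i * a (π i)`. -/
def twelfthMomentP : List ℤ :=
  [0, 0, 0, -19321772487671808000, -21834439351436574720, 81567721005848985600,
    98054263830910353408, -141693016926824294400, -185059424465016072192, 134122804734489924864,
    194047741098775708352, -81915729240443955864, -131412303571503464177, 35700123076805662524,
    62978591089023868557, -10274437820423501424, -20786269171121829492, 2235383686296651744,
    4653350083598521812, -525182587729448544, -706092331699488942, 122334382165726584,
    67328884040033382, -19985862450781584, -2581463315056452, 1812948273005184,
    -183575185104636, -52330688594184, 18789497701975, -2577647572500, 153431403125]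

theorem moments_eq : moments = some (scaleP 192477363523279209375 sixthMomentP,
    scaleP 16740145128484648794958335266199609375 twelfthMomentP) := by
  decide +kernel

/-! ### Power sums of the centred ranks -/

theorem sum_centred_of_telescope (f F : ℝ → ℝ) (hF : ∀ y, F (-y) = -F y)
    (hf : ∀ y, F (y + 2) - F y = 2 * f (y + 1)) (n : ℕ) :
    ∑ i : Fin n, f (2 * i + 1 - n) = F n := by
  have h : ∀ i : ℕ, 2 * f (2 * i + 1 - n) = F (2 * (i + 1 : ℕ) - n) - F (2 * i - n) := by
    intro i
    have := hf (2 * i - n)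
    push_cast
    ring_nf at this ⊢
    linarith
  rw [Fin.sum_univ_eq_sum_range fun i => f (2 * i + 1 - n)]
  refine mul_left_cancel₀ two_ne_zero ?_
  rw [mul_sum, sum_congr rfl fun i _ => h i, sum_range_sub fun i : ℕ => F (2 * i - n)]
  have := hF n
  simp only [Nat.cast_zero, mul_zero, zero_sub]
  rw [this]
  ring_nf

theorem sum_centred_pow_odd {x : ℕ} (hx : Odd x) (w : ℝ) (n : ℕ) :
    ∑ i : Fin n, (w * (2 * i + 1 - n)) ^ x = 0 := by
  have h : ∑ i : Fin n, (w * (2 * i + 1 - n)) ^ x = -∑ i : Fin n, (w * (2 * i + 1 - n)) ^ x := by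
    conv_lhs => rw [← Equiv.sum_comp Fin.revPerm]
    rw [← sum_neg_distrib]
    refine sum_congr rfl fun i _ => ?_
    rw [← hx.neg_pow, Fin.revPerm_apply, Fin.val_rev, Nat.cast_sub (by omega)]
    push_cast
    ring
  linarith

theorem hasPowerSums_centred {w : ℝ} (hw : w ^ 2 = 15015) :
    HasPowerSums fun i : Fin n => w * (2 * i + 1 - n) := by
  have hpow : ∀ (k : ℕ) (y : ℝ), (w * y) ^ (2 * k) = 15015 ^ k * y ^ (2 * k) := by
    intro k y
    rw [mul_pow, pow_mul, hw]
  intro x p h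
  unfold powerSumP at h
  split at h
  case h_7 =>
    split_ifs at h with hx
    cases h
    exact sum_centred_pow_odd (Nat.odd_iff.mpr hx) w n
  all_goals
    cases h
    refine sum_centred_of_telescope (fun y => (w * y) ^ _) (fun y => evalP y _) ?_ ?_ n <;> intro y
    · simp only [evalP]
      push_cast
      ring
  · simp only [hpow 1, evalP]; push_cast; ring
  · simp only [hpow 2, evalP]; push_cast; ring
  · simp only [hpow 3, evalP]; push_cast; ring
  · simp only [hpow 4, evalP]; push_cast; ring
  · simp only [hpow 5, evalP]; push_cast; ring
  · simp only [hpow 6, evalP]; push_cast; ring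

theorem sum_perm_pow_spearman (a : Fin n → ℝ) (ha : ∀ i, a i = (i : ℝ) + 1 - ((n : ℝ) + 1) / 2) :
    ∑ π : Perm (Fin n), (∑ i, a i * a (π i)) ^ 6 =
      n.factorial * (evalP n sixthMomentP / 243855360) ∧
    ∑ π : Perm (Fin n), (∑ i, a i * a (π i)) ^ 12 =
      n.factorial * (evalP n twelfthMomentP / 131602674572328960000) := by
  have hw : (√15015 : ℝ) ^ 2 = 15015 := Real.sq_sqrt (by norm_num)
  obtain ⟨h6, h12⟩ := sum_perm_pow_of_moments (n := n) (hasPowerSums_centred hw) moments_eq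
  have hb : ∀ π : Perm (Fin n), ∑ i : Fin n, √15015 * (2 * i + 1 - n) *
      (√15015 * (2 * (π i : ℕ) + 1 - n)) = 60060 * ∑ i, a i * a (π i) := by
    intro π
    rw [mul_sum]
    refine sum_congr rfl fun i _ => ?_
    rw [ha, ha]
    linear_combination (2 * (i : ℝ) + 1 - n) * (2 * ((π i : ℕ) : ℝ) + 1 - n) * hw
  simp only [hb, mul_pow, ← mul_sum, evalP_scaleP] at h6 h12
  constructor
  · push_cast at h6
    linarith
  · push_cast at h12
    linarith

end SpearmanMoment

/-- Null variance of the sixth power of Spearman's rho. -/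
theorem stmt7 (n : ℕ) (hn : 2 ≤ n)
    (a : Fin n → ℝ) (ha : ∀ i, a i = (i : ℝ) + 1 - ((n : ℝ) + 1) / 2)
    (ρ : Perm (Fin n) → ℝ)
    (hρ : ∀ π, ρ π = (12 / ((n : ℝ) * ((n : ℝ) ^ 2 - 1))) * ∑ i, a i * a (π i))
    (M : ℕ → ℝ)
    (hM : ∀ r, M r = (1 / (n.factorial : ℝ)) * ∑ π : Perm (Fin n), (ρ π) ^ r) :
    M 12 - (M 6) ^ 2 = 18 * ((n : ℝ) - 2) *
        (1576158959375 * (n : ℝ) ^ 22 - 26956502698125 * (n : ℝ) ^ 21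
          + 204016193881500 * (n : ℝ) ^ 20 - 656132617822682 * (n : ℝ) ^ 19
          - 1171932384888603 * (n : ℝ) ^ 18 + 16913917053629829 * (n : ℝ) ^ 17
          - 33663135573263722 * (n : ℝ) ^ 16 - 143066811467638476 * (n : ℝ) ^ 15
          + 610987613264235129 * (n : ℝ) ^ 14 + 596842447834386253 * (n : ℝ) ^ 13
          - 5189139972464602944 * (n : ℝ) ^ 12 - 1409441833203864570 * (n : ℝ) ^ 11
          + 27750786105920376371 * (n : ℝ) ^ 10 + 4444828679768649627 * (n : ℝ) ^ 9
          - 95698023681505100946 * (n : ℝ) ^ 8 - 19996738740525207104 * (n : ℝ) ^ 7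
          + 206938856876542180608 * (n : ℝ) ^ 6 + 34634552355461373696 * (n : ℝ) ^ 5
          - 313861911687028044288 * (n : ℝ) ^ 4 - 56314087053512122368 * (n : ℝ) ^ 3
          + 270499002102369976320 * (n : ℝ) ^ 2 + 37528151745373470720 * (n : ℝ)
          - 101439305560276992000) /
      (2789661875 * (n : ℝ) ^ 9 * ((n : ℝ) - 1) ^ 11 * ((n : ℝ) + 1) ^ 9) := by
  have hn₁ : (n : ℝ) - 1 ≠ 0 := by
    have : (2 : ℝ) ≤ n := by exact_mod_cast hn
    linarith
  have hn₀ : (n : ℝ) ≠ 0 := by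
    have : n ≠ 0 := by omega
    exact_mod_cast this
  have hn₂ : (n : ℝ) + 1 ≠ 0 := by positivity
  have hf : (n.factorial : ℝ) ≠ 0 := by exact_mod_cast n.factorial_ne_zero
  obtain ⟨h6, h12⟩ := SpearmanMoment.sum_perm_pow_spearman a ha
  have hD : (n : ℝ) * ((n : ℝ) ^ 2 - 1) = n * (n - 1) * (n + 1) := by ring
  simp only [hM, hρ, mul_pow, ← mul_sum, h6, h12, hD]
  simp only [SpearmanMoment.sixthMomentP, SpearmanMoment.twelfthMomentP, SpearmanMoment.evalP]
  push_cast
  field_simp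
  ring
end

section
/- The Blum–Kiefer–Rosenblatt pattern kernel ψ_R on S_6 takes exactly the five values 1, 1/2, 0, −1/4 and −1/2; moreover #{σ ∈ S_6 : ψ_R(σ) = 1} = 80, #{σ ∈ S_6 : ψ_R(σ) = 1/2} = 128, #{σ ∈ S_6 : ψ_R(σ) = 0} = 64, #{σ ∈ S_6 : ψ_R(σ) = −1/4} = 320 and #{σ ∈ S_6 : ψ_R(σ) = −1/2} = 128. -/
open Finset Equiv

namespace BlumKieferRosenblatt

/-- The product of differences `A_{6,a}`, with integer values, for a comparison table `L`, where
`L i j` stands for `1(u_i ≤ u_j)`, and an arrangement `w` of the indices. -/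
def diffProd (L : Fin 6 → Fin 6 → ℤ) (w : Fin 6 → Fin 6) (a : Fin 6) : ℤ :=
  (L (w 0) (w a) - L (w 1) (w a)) * (L (w 2) (w a) - L (w 3) (w a))

/-- The comparison table of the entries of `s`. -/
def leTable (s : Fin 6 → Fin 6) (i j : Fin 6) : ℤ := if s i ≤ s j then 1 else 0

/-- The tuples `(i, j, k, l, p, q)` of distinct indices with `i < j < p < k < l`. Up to rearrangement
of the first four entries these are the permutations at which the factor of the
identity vector does not vanish. -/
def splits : List (Fin 6 × Fin 6 × Fin 6 × Fin 6 × Fin 6 × Fin 6) :=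
  [(0, 1, 4, 5, 2, 3), (0, 1, 3, 5, 2, 4), (0, 1, 3, 4, 2, 5),
   (1, 2, 4, 5, 3, 0), (0, 2, 4, 5, 3, 1), (0, 1, 4, 5, 3, 2)]

/-- The sixteen arrangements of `(i, j, k, l, p, q)` that keep `p, q` in the last two places and
separate `{i, j}` from `{k, l}` in each of the first two pairs. -/
def arrangements : Fin 6 × Fin 6 × Fin 6 × Fin 6 × Fin 6 × Fin 6 → List (Fin 6 → Fin 6)
  | (i, j, k, l, p, q) =>
    [(i, j), (j, i)].flatMap fun x => [(k, l), (l, k)].flatMap fun y =>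
      [![x.1, y.1, x.2, y.2, p, q], ![y.1, x.1, x.2, y.2, p, q],
       ![x.1, y.1, y.2, x.2, p, q], ![y.1, x.1, y.2, x.2, p, q]]

/-- The permutations at which the factor of the identity vector does not vanish. -/
theorem filter_diffProd_id_ne_zero :
    ((univ : Finset (Perm (Fin 6))).val.filter
      fun ω : Perm (Fin 6) => diffProd (leTable id) ω 4 ≠ 0).map
        (fun ω : Perm (Fin 6) => (ω : Fin 6 → Fin 6)) =
    (splits.flatMap arrangements : List (Fin 6 → Fin 6)) := by
  decide +kernel

/-- Four times the pattern kernel, as a sum over `splits`. -/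
def fourPsi (L : Fin 6 → Fin 6 → ℤ) : ℤ :=
  (splits.map fun (i, j, k, l, _, q) =>
    (L i q - L k q) * (L j q - L l q) + (L i q - L l q) * (L j q - L k q)).sum

theorem sum_diffProd_mul_diffProd (L : Fin 6 → Fin 6 → ℤ) :
    ∑ ω : Perm (Fin 6), diffProd (leTable id) ω 4 * diffProd L ω 5 = 8 * fourPsi L := by
  have hsum : ∑ ω : Perm (Fin 6), diffProd (leTable id) ω 4 * diffProd L ω 5 =
      ((splits.flatMap arrangements).map
        fun w => diffProd (leTable id) w 4 * diffProd L w 5).sum := by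
    rw [← Multiset.sum_coe, ← Multiset.map_coe, ← filter_diffProd_id_ne_zero, Multiset.map_map,
      ← Finset.filter_val]
    symm
    refine Finset.sum_filter_of_ne fun ω _ h => left_ne_zero_of_mul h
  rw [hsum]
  simp [splits, arrangements, fourPsi, diffProd, leTable]
  ring

theorem fourPsi_mem (σ : Perm (Fin 6)) : fourPsi (leTable σ) ∈ [4, 2, 0, -1, -2] := by
  revert σ
  decide +kernel

theorem card_fourPsi_eq :
    [4, 2, 0, -1, -2].map
      (fun c : ℤ => #{σ : Perm (Fin 6) | fourPsi (leTable σ) = c}) = [80, 128, 64, 320, 128] := by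
  decide +kernel

end BlumKieferRosenblatt

open BlumKieferRosenblatt in
/-- The Blum–Kiefer–Rosenblatt pattern kernel `ψ_R` on `S₆` takes
exactly the values `1` (80), `1/2` (128), `0` (64), `−1/4` (320), `−1/2` (128). -/
theorem stmt15
    (A : (Fin 6 → ℝ) → Perm (Fin 6) → Fin 6 → ℝ)
    (hA : ∀ u ω a, A u ω a =
        ((if u (ω 0) ≤ u (ω a) then (1 : ℝ) else 0)
          - (if u (ω 1) ≤ u (ω a) then (1 : ℝ) else 0))
      * ((if u (ω 2) ≤ u (ω a) then (1 : ℝ) else 0)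
          - (if u (ω 3) ≤ u (ω a) then (1 : ℝ) else 0)))
    (vec : Perm (Fin 6) → Fin 6 → ℝ)
    (hvec : ∀ σ i, vec σ i = ((σ i).val : ℝ) + 1)
    (e : Fin 6 → ℝ) (he : ∀ i, e i = ((i : ℕ) : ℝ) + 1)
    (ψ : Perm (Fin 6) → ℝ)
    (hψ : ∀ σ, ψ σ = (1 / 32) * ∑ ω : Perm (Fin 6), A e ω 4 * A (vec σ) ω 5) :
    (∀ σ, ψ σ = 1 ∨ ψ σ = 1 / 2 ∨ ψ σ = 0 ∨ ψ σ = -(1 / 4) ∨ ψ σ = -(1 / 2)) ∧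
    (Finset.univ.filter (fun σ : Perm (Fin 6) => ψ σ = 1)).card = 80 ∧
    (Finset.univ.filter (fun σ : Perm (Fin 6) => ψ σ = 1 / 2)).card = 128 ∧
    (Finset.univ.filter (fun σ : Perm (Fin 6) => ψ σ = 0)).card = 64 ∧
    (Finset.univ.filter (fun σ : Perm (Fin 6) => ψ σ = -(1 / 4))).card = 320 ∧
    (Finset.univ.filter (fun σ : Perm (Fin 6) => ψ σ = -(1 / 2))).card = 128 := by
  have hψ' : ∀ σ, ψ σ = (fourPsi (leTable σ) : ℝ) / 4 := by
    intro σ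
    have hid : ∀ ω : Perm (Fin 6), A e ω 4 = (diffProd (leTable id) ω 4 : ℤ) := by
      intro ω
      simp [hA, he, diffProd, leTable]
    have hσ : ∀ ω : Perm (Fin 6), A (vec σ) ω 5 = (diffProd (leTable σ) ω 5 : ℤ) := by
      intro ω
      simp [hA, hvec, diffProd, leTable]
    have h := congrArg (Int.cast : ℤ → ℝ) (sum_diffProd_mul_diffProd (leTable σ))
    push_cast at h
    simp only [hψ, hid, hσ, h]
    ring
  have hiff : ∀ (x : ℝ) (c : ℤ), x = c / 4 → ∀ σ, ψ σ = x ↔ fourPsi (leTable σ) = c := by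
    intro x c hx σ
    rw [hψ', hx, div_left_inj' (by norm_num), Int.cast_inj]
  have h1 := hiff 1 4 (by norm_num)
  have h2 := hiff (1 / 2) 2 (by norm_num)
  have h3 := hiff 0 0 (by norm_num)
  have h4 := hiff (-(1 / 4)) (-1) (by norm_num)
  have h5 := hiff (-(1 / 2)) (-2) (by norm_num)
  have hcard := card_fourPsi_eq
  simp only [List.map_cons, List.map_nil, List.cons.injEq, and_true] at hcard
  simp only [h1, h2, h3, h4, h5]
  refine ⟨fun σ => by simpa using fourPsi_mem σ, ?_⟩
  convert hcard
end

section
/- Let ψ_{τ*} : S_4 → ℝ be the Bergsma–Dassios–Yanagimoto pattern kernel and, for 4 ≤ b ≤ 8, define Ω_{τ*,2,b} = (1/b!) Σ_{π ∈ S_b} Σ_{(I_1,I_2)} ψ_{τ*}(pat_{I_1}(π)) ψ_{τ*}(pat_{I_2}(π)), where the inner sum is over all ordered pairs (I_1, I_2) of 4-element subsets of {1,…,b} with I_1 ∪ I_2 = {1,…,b}. Then Ω_{τ*,2,4} = 2/9, Ω_{τ*,2,5} = 32/45, Ω_{τ*,2,6} = 2/5, Ω_{τ*,2,7} = 0 and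 Ω_{τ*,2,8} = 0. -/
open Finset Equiv

/-- Both `a` and `b` lie below both `c` and `d`. It is built from `Nat.blt` so that the kernel
evaluates it quickly. -/
def allBelow (a b c d : ℕ) : Bool :=
  Nat.blt a c && Nat.blt a d && Nat.blt b c && Nat.blt b d

lemma allBelow_eq_true {a b c d : ℕ} :
    allBelow a b c d = true ↔ a < c ∧ a < d ∧ b < c ∧ b < d := by
  simp only [allBelow, Bool.and_eq_true, Nat.blt_eq, and_assoc]

/-- Three times the Bergsma–Dassios–Yanagimoto kernel on a sequence of distinct naturals: it is `2`
when one of the pairs `{a, b}`, `{c, d}` lies entirely below the other one, and `-1` otherwise. -/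
def sepKernel (a b c d : ℕ) : ℤ :=
  bif allBelow a b c d || allBelow c d a b then 2 else -1

lemma sepKernel_eq_ite (a b c d : ℕ) :
    sepKernel a b c d = if (a < c ∧ a < d ∧ b < c ∧ b < d) ∨ (c < a ∧ c < b ∧ d < a ∧ d < b)
      then 2 else -1 := by
  simp only [sepKernel, cond_eq_ite, Bool.or_eq_true, allBelow_eq_true]

lemma sepKernel_swap_left (a b c d : ℕ) : sepKernel a b c d = sepKernel b a c d := by
  simp only [sepKernel_eq_ite]
  congr 1
  grind

lemma sepKernel_swap_pairs (a b c d : ℕ) : sepKernel a b c d = sepKernel c d a b := by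
  simp only [sepKernel_eq_ite]
  congr 1
  grind

/-- Exactly one of the three ways of splitting four distinct values into pairs is separated. -/
lemma sepKernel_add_rotate {a b c d : ℕ} (hab : a ≠ b) (hac : a ≠ c) (had : a ≠ d) (hbc : b ≠ c)
    (hbd : b ≠ d) (hcd : c ≠ d) :
    sepKernel a b c d + sepKernel a c d b + sepKernel a d b c = 0 := by
  simp only [sepKernel_eq_ite]
  rcases hab.lt_or_gt with h1 | h1 <;> rcases hac.lt_or_gt with h2 | h2 <;>
    rcases had.lt_or_gt with h3 | h3 <;> rcases hbc.lt_or_gt with h4 | h4 <;>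
    rcases hbd.lt_or_gt with h5 | h5 <;> rcases hcd.lt_or_gt with h6 | h6 <;>
    omega

/-- Rotating any three entries of a sequence of four distinct values gives three values of
`sepKernel` which add up to zero. -/
lemma exists_perm_sum_sepKernel_eq_zero (m : Fin 4) :
    ∃ c : Perm (Fin 4), c m = m ∧ ∀ w : Fin 4 → ℕ, Function.Injective w →
      sepKernel (w 0) (w 1) (w 2) (w 3) + sepKernel (w (c 0)) (w (c 1)) (w (c 2)) (w (c 3)) +
        sepKernel (w (c (c 0))) (w (c (c 1))) (w (c (c 2))) (w (c (c 3))) = 0 := by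
  have rotate {w : Fin 4 → ℕ} (hw : Function.Injective w) {i j k l : Fin 4}
      (h : [i, j, k, l].Nodup) : sepKernel (w i) (w j) (w k) (w l) +
        sepKernel (w i) (w k) (w l) (w j) + sepKernel (w i) (w l) (w j) (w k) = 0 := by
    simp only [List.nodup_cons, List.mem_cons, List.not_mem_nil, or_false, not_or] at h
    exact sepKernel_add_rotate (hw.ne h.1.1) (hw.ne h.1.2.1) (hw.ne h.1.2.2) (hw.ne h.2.1.1)
      (hw.ne h.2.1.2) (hw.ne h.2.2.1)
  fin_cases m
  · refine ⟨swap 1 2 * swap 2 3, by decide, fun w hw => ?_⟩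
    exact rotate hw (i := 0) (j := 1) (k := 2) (l := 3) (by decide)
  · refine ⟨swap 0 2 * swap 2 3, by decide, fun w hw => ?_⟩
    have h := rotate hw (i := 1) (j := 0) (k := 2) (l := 3) (by decide)
    rw [sepKernel_swap_left, sepKernel_swap_left _ (w 2), sepKernel_swap_left _ (w 3)] at h
    exact h
  · refine ⟨swap 0 1 * swap 1 3, by decide, fun w hw => ?_⟩
    have h := rotate hw (i := 2) (j := 3) (k := 0) (l := 1) (by decide)
    rw [sepKernel_swap_pairs, sepKernel_swap_pairs (w 2) (w 0),
      sepKernel_swap_pairs (w 2) (w 1)] at h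
    exact h
  · refine ⟨swap 0 1 * swap 1 2, by decide, fun w hw => ?_⟩
    have h := rotate hw (i := 3) (j := 2) (k := 0) (l := 1) (by decide)
    rw [sepKernel_swap_left, sepKernel_swap_left _ (w 0), sepKernel_swap_left _ (w 1),
      sepKernel_swap_pairs, sepKernel_swap_pairs (w 0) (w 3), sepKernel_swap_pairs (w 1) (w 3),
      sepKernel_swap_left (w 1), sepKernel_swap_left (w 2)] at h
    exact h

/-- The sign kernel `B₄` underlying `τ*`, on a sequence of naturals. -/
def signKernel (a b c d : ℕ) : ℤ :=
  (allBelow a c b d).toInt + (allBelow b d a c).toInt - (allBelow a d b c).toInt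
    - (allBelow b c a d).toInt

lemma sum_signKernel_mul_signKernel (σ : Perm (Fin 4)) :
    ∑ ω : Perm (Fin 4), signKernel (ω 0) (ω 1) (ω 2) (ω 3) *
        signKernel (σ (ω 0)) (σ (ω 1)) (σ (ω 2)) (σ (ω 3)) =
      8 * sepKernel (σ 0) (σ 1) (σ 2) (σ 3) := by
  revert σ
  decide +kernel

lemma ite_max_lt_min_eq_toInt_allBelow (a b c d : ℕ) :
    (if max ((a : ℝ) + 1) (b + 1) < min ((c : ℝ) + 1) (d + 1) then (1 : ℝ) else 0) =
      (allBelow a b c d).toInt := by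
  have h : max ((a : ℝ) + 1) (b + 1) < min ((c : ℝ) + 1) (d + 1) ↔ allBelow a b c d = true := by
    simp only [allBelow_eq_true, max_lt_iff, lt_min_iff, add_lt_add_iff_right, Nat.cast_lt]
    tauto
  cases hb : allBelow a b c d <;> simp [h, hb]

/-- The value of `sepKernel` on the restriction of `π` to a four-element set. -/
def subsetKernel {b : ℕ} (π : Perm (Fin b)) (I : Finset (Fin b)) : ℤ :=
  if h : I.card = 4 then
    sepKernel (π (I.orderEmbOfFin h 0)) (π (I.orderEmbOfFin h 1)) (π (I.orderEmbOfFin h 2))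
      (π (I.orderEmbOfFin h 3))
  else 0

lemma strictMono_quadruple {b : ℕ} {i j k l : Fin b} (h : i < j ∧ j < k ∧ k < l) :
    StrictMono ![i, j, k, l] := by
  simp [Fin.strictMono_iff_lt_succ, Fin.forall_fin_succ, h]

/-- The set of entries of a quadruple. -/
def quadrupleSet {b : ℕ} (q : Fin b × Fin b × Fin b × Fin b) : Finset (Fin b) :=
  {q.1, q.2.1, q.2.2.1, q.2.2.2}

lemma coe_quadrupleSet {b : ℕ} (q : Fin b × Fin b × Fin b × Fin b) :
    (quadrupleSet q : Set (Fin b)) = Set.range ![q.1, q.2.1, q.2.2.1, q.2.2.2] := by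
  ext x
  simp [quadrupleSet]
  tauto

lemma card_quadrupleSet {b : ℕ} {q : Fin b × Fin b × Fin b × Fin b}
    (h : q.1 < q.2.1 ∧ q.2.1 < q.2.2.1 ∧ q.2.2.1 < q.2.2.2) : (quadrupleSet q).card = 4 := by
  rw [← Set.ncard_coe_finset, coe_quadrupleSet, Set.ncard_range_of_injective
    (strictMono_quadruple h).injective]
  simp

lemma subsetKernel_quadrupleSet {b : ℕ} (π : Perm (Fin b)) {q : Fin b × Fin b × Fin b × Fin b}
    (h : q.1 < q.2.1 ∧ q.2.1 < q.2.2.1 ∧ q.2.2.1 < q.2.2.2) :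
    subsetKernel π (quadrupleSet q) = sepKernel (π q.1) (π q.2.1) (π q.2.2.1) (π q.2.2.2) := by
  have hemb := orderEmbOfFin_unique (card_quadrupleSet h) (f := ![q.1, q.2.1, q.2.2.1, q.2.2.2])
    (by simp [Fin.forall_fin_succ, quadrupleSet]) (strictMono_quadruple h)
  rw [subsetKernel, dif_pos (card_quadrupleSet h), ← hemb]
  rfl

lemma quadrupleSet_injOn {b : ℕ} : Set.InjOn quadrupleSet
    {q : Fin b × Fin b × Fin b × Fin b | q.1 < q.2.1 ∧ q.2.1 < q.2.2.1 ∧ q.2.2.1 < q.2.2.2} := by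
  intro p hp q hq hpq
  rw [← coe_inj, coe_quadrupleSet, coe_quadrupleSet,
    (strictMono_quadruple hp).range_inj (strictMono_quadruple hq)] at hpq
  ext
  · exact congrArg Fin.val (congrFun hpq 0)
  · exact congrArg Fin.val (congrFun hpq 1)
  · exact congrArg Fin.val (congrFun hpq 2)
  · exact congrArg Fin.val (congrFun hpq 3)

/-- If two four-element sets share at most one point, the corresponding kernels are
uncorrelated. -/
lemma sum_subsetKernel_mul_subsetKernel_eq_zero {b : ℕ} {I J : Finset (Fin b)}
    (hI : I.card = 4) (hIJ : (I ∩ J).card ≤ 1) :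
    ∑ π : Perm (Fin b), subsetKernel π I * subsetKernel π J = 0 := by
  set f := I.orderEmbOfFin hI with hf
  obtain ⟨m, hm⟩ : ∃ m : Fin 4, ∀ a, f a ∈ J → a = m := by
    by_cases h : ∃ m, f m ∈ J
    · obtain ⟨m, hm⟩ := h
      refine ⟨m, fun a ha => f.injective ?_⟩
      exact card_le_one.mp hIJ _ (mem_inter.mpr ⟨orderEmbOfFin_mem _ _ _, ha⟩) _
        (mem_inter.mpr ⟨orderEmbOfFin_mem _ _ _, hm⟩)
    · exact ⟨0, fun a ha => absurd ⟨a, ha⟩ h⟩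
  obtain ⟨c, hcm, hc⟩ := exists_perm_sum_sepKernel_eq_zero m
  set C : Perm (Fin b) := c.viaFintypeEmbedding f.toEmbedding with hC
  have hCf (a : Fin 4) : C (f a) = f (c a) := Perm.viaFintypeEmbedding_apply_image c f.toEmbedding a
  have hCJ (x : Fin b) (hx : x ∈ J) : C x = x := by
    by_cases hxf : x ∈ Set.range f
    · obtain ⟨a, rfl⟩ := hxf
      rw [hCf, hm a hx, hcm]
    · exact Perm.viaFintypeEmbedding_apply_notMem_range c f.toEmbedding hxf
  have hJ (π : Perm (Fin b)) : subsetKernel (π * C) J = subsetKernel π J := by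
    unfold subsetKernel
    split_ifs with h
    · simp only [Perm.mul_apply, hCJ _ (orderEmbOfFin_mem J h _)]
    · rfl
  have hsum (π : Perm (Fin b)) :
      subsetKernel π I + subsetKernel (π * C) I + subsetKernel (π * C * C) I = 0 := by
    simp only [subsetKernel, dif_pos hI, ← hf, Perm.mul_apply, hCf]
    exact hc (fun a => (π (f a) : ℕ)) (Fin.val_injective.comp (π.injective.comp f.injective))
  have hshift (F : Perm (Fin b) → ℤ) : ∑ π, F (π * C) = ∑ π, F π :=
    Equiv.sum_comp (Equiv.mulRight C) F
  have htriple : ∑ π : Perm (Fin b), (subsetKernel π I + subsetKernel (π * C) I +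
      subsetKernel (π * C * C) I) * subsetKernel π J = 0 := by
    simp only [hsum, zero_mul, sum_const_zero]
  have hone := hshift fun π => subsetKernel π I * subsetKernel π J
  have htwo := hshift fun π => subsetKernel (π * C) I * subsetKernel π J
  simp only [hJ] at hone htwo
  simp only [add_mul, sum_add_distrib] at htriple
  linarith

/-- A sum over permutations can be computed by running through the list of their words. -/
lemma sum_perm_eq_sum_permutations (b : ℕ) (F : List ℕ → ℤ) :
    ∑ π : Perm (Fin b), F (List.ofFn fun i => (π i : ℕ)) =
      ((List.range b).permutations'.map F).sum := by
  have hperm := List.permutations_perm_permutations' (List.range b)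
  have hnodup : (List.range b).permutations'.Nodup :=
    hperm.nodup_iff.mp (List.nodup_permutations _ List.nodup_range)
  have hinj : Function.Injective fun π : Perm (Fin b) => List.ofFn fun i => (π i : ℕ) := by
    intro π ρ h
    ext i
    exact congrFun (List.ofFn_injective h) i
  have himage : univ.image (fun π : Perm (Fin b) => List.ofFn fun i => (π i : ℕ)) =
      (List.range b).permutations'.toFinset := by
    apply eq_of_subset_of_card_le
    · intro l hl
      obtain ⟨π, -, rfl⟩ := mem_image.mp hl
      rw [List.mem_toFinset, List.mem_permutations']
      refine (List.perm_ext_iff_of_nodup ?_ List.nodup_range).mpr fun x => ?_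
      · exact List.nodup_ofFn.mpr (Fin.val_injective.comp π.injective)
      · rw [List.mem_ofFn, List.mem_range]
        exact ⟨fun ⟨i, hi⟩ => hi ▸ (π i).isLt, fun hx => ⟨π.symm ⟨x, hx⟩, by simp⟩⟩
    · rw [card_image_of_injective _ hinj, List.toFinset_card_of_nodup hnodup,
        ← hperm.length_eq, List.length_permutations, List.length_range, card_univ,
        Fintype.card_perm, Fintype.card_fin]
  rw [← List.sum_toFinset _ hnodup, ← himage, sum_image hinj.injOn]

/-- The pairs of four-element sets which together cover everything. -/
def coveringPairs (b : ℕ) : Finset (Finset (Fin b) × Finset (Fin b)) :=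
  univ.filter fun I => I.1.card = 4 ∧ I.2.card = 4 ∧ I.1 ∪ I.2 = univ

lemma sum_coveringPairs {b : ℕ} (g : Finset (Fin b) → ℤ) :
    ∑ I ∈ coveringPairs b, g I.1 * g I.2 = ∑ I ∈ powersetCard 4 univ,
      g I * ∑ J ∈ (powersetCard 4 univ).filter (fun J => I ∪ J = univ), g J := by
  have hpairs : coveringPairs b = (powersetCard 4 univ ×ˢ powersetCard 4 univ).filter
      fun I => I.1 ∪ I.2 = univ := by
    ext I
    simp [coveringPairs, mem_powersetCard, and_assoc]
  rw [hpairs, sum_filter, sum_product]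
  refine sum_congr rfl fun I _ => ?_
  rw [mul_sum, sum_filter]

/-- A list of all increasing quadruples turns the sum over covering pairs into an explicit sum. -/
lemma sum_coveringPairs_eq_of_list {b : ℕ} (π : Perm (Fin b))
    (L : List (Fin b × Fin b × Fin b × Fin b))
    (hlt : ∀ q ∈ L, q.1 < q.2.1 ∧ q.2.1 < q.2.2.1 ∧ q.2.2.1 < q.2.2.2)
    (hL : L.Nodup) (hlength : L.length = b.choose 4) :
    ∑ I ∈ coveringPairs b, subsetKernel π I.1 * subsetKernel π I.2 =
      (L.map fun p => sepKernel (π p.1) (π p.2.1) (π p.2.2.1) (π p.2.2.2) *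
        (L.map fun q => if quadrupleSet p ∪ quadrupleSet q = univ then
          sepKernel (π q.1) (π q.2.1) (π q.2.2.1) (π q.2.2.2) else 0).sum).sum := by
  have hinj : Set.InjOn quadrupleSet (L.toFinset : Set (Fin b × Fin b × Fin b × Fin b)) :=
    quadrupleSet_injOn.mono fun q hq => hlt q (List.mem_toFinset.mp hq)
  have hsets : powersetCard 4 univ = L.toFinset.image quadrupleSet := by
    refine (eq_of_subset_of_card_le ?_ ?_).symm
    · intro I hI
      obtain ⟨q, hq, rfl⟩ := mem_image.mp hI
      exact mem_powersetCard.mpr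
        ⟨subset_univ _, card_quadrupleSet (hlt q (List.mem_toFinset.mp hq))⟩
    · rw [card_image_of_injOn hinj, List.toFinset_card_of_nodup hL, hlength, card_powersetCard,
        card_univ, Fintype.card_fin]
  simp only [sum_coveringPairs, sum_filter, hsets, sum_image hinj, List.sum_toFinset _ hL]
  refine congrArg List.sum (List.map_congr_left fun p hp => ?_)
  refine congrArg₂ _ (subsetKernel_quadrupleSet π (hlt p hp))
    (congrArg List.sum (List.map_congr_left fun q hq => ?_))
  rw [subsetKernel_quadrupleSet π (hlt q hq)]

/-- The sum of the products of `sepKernel` over the pairs of covering subwords of length four. -/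
def coveringSum : List ℕ → ℤ
  | [a, b, c, d] => sepKernel a b c d * sepKernel a b c d
  | [a, b, c, d, e] =>
    sepKernel a b c d * (sepKernel a b c e + sepKernel a b d e + sepKernel a c d e +
      sepKernel b c d e) +
    sepKernel a b c e * (sepKernel a b c d + sepKernel a b d e + sepKernel a c d e +
      sepKernel b c d e) +
    sepKernel a b d e * (sepKernel a b c d + sepKernel a b c e + sepKernel a c d e +
      sepKernel b c d e) +
    sepKernel a c d e * (sepKernel a b c d + sepKernel a b c e + sepKernel a b d e +
      sepKernel b c d e) +
    sepKernel b c d e * (sepKernel a b c d + sepKernel a b c e + sepKernel a b d e +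
      sepKernel a c d e)
  | [a, b, c, d, e, f] =>
    sepKernel a b c d * (sepKernel a b e f + sepKernel a c e f + sepKernel a d e f +
      sepKernel b c e f + sepKernel b d e f + sepKernel c d e f) +
    sepKernel a b c e * (sepKernel a b d f + sepKernel a c d f + sepKernel a d e f +
      sepKernel b c d f + sepKernel b d e f + sepKernel c d e f) +
    sepKernel a b c f * (sepKernel a b d e + sepKernel a c d e + sepKernel a d e f +
      sepKernel b c d e + sepKernel b d e f + sepKernel c d e f) +
    sepKernel a b d e * (sepKernel a b c f + sepKernel a c d f + sepKernel a c e f +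
      sepKernel b c d f + sepKernel b c e f + sepKernel c d e f) +
    sepKernel a b d f * (sepKernel a b c e + sepKernel a c d e + sepKernel a c e f +
      sepKernel b c d e + sepKernel b c e f + sepKernel c d e f) +
    sepKernel a b e f * (sepKernel a b c d + sepKernel a c d e + sepKernel a c d f +
      sepKernel b c d e + sepKernel b c d f + sepKernel c d e f) +
    sepKernel a c d e * (sepKernel a b c f + sepKernel a b d f + sepKernel a b e f +
      sepKernel b c d f + sepKernel b c e f + sepKernel b d e f) +
    sepKernel a c d f * (sepKernel a b c e + sepKernel a b d e + sepKernel a b e f +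
      sepKernel b c d e + sepKernel b c e f + sepKernel b d e f) +
    sepKernel a c e f * (sepKernel a b c d + sepKernel a b d e + sepKernel a b d f +
      sepKernel b c d e + sepKernel b c d f + sepKernel b d e f) +
    sepKernel a d e f * (sepKernel a b c d + sepKernel a b c e + sepKernel a b c f +
      sepKernel b c d e + sepKernel b c d f + sepKernel b c e f) +
    sepKernel b c d e * (sepKernel a b c f + sepKernel a b d f + sepKernel a b e f +
      sepKernel a c d f + sepKernel a c e f + sepKernel a d e f) +
    sepKernel b c d f * (sepKernel a b c e + sepKernel a b d e + sepKernel a b e f +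
      sepKernel a c d e + sepKernel a c e f + sepKernel a d e f) +
    sepKernel b c e f * (sepKernel a b c d + sepKernel a b d e + sepKernel a b d f +
      sepKernel a c d e + sepKernel a c d f + sepKernel a d e f) +
    sepKernel b d e f * (sepKernel a b c d + sepKernel a b c e + sepKernel a b c f +
      sepKernel a c d e + sepKernel a c d f + sepKernel a c e f) +
    sepKernel c d e f * (sepKernel a b c d + sepKernel a b c e + sepKernel a b c f +
      sepKernel a b d e + sepKernel a b d f + sepKernel a b e f)
  | _ => 0

lemma sum_coveringPairs_four (π : Perm (Fin 4)) :
    ∑ I ∈ coveringPairs 4, subsetKernel π I.1 * subsetKernel π I.2 =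
      coveringSum (List.ofFn fun i => (π i : ℕ)) := by
  rw [sum_coveringPairs_eq_of_list π
    [(0, 1, 2, 3)]
    (by decide +kernel) (by decide +kernel) rfl]
  simp +decide only [List.map_cons, List.map_nil, List.sum_cons, List.sum_nil, if_true,
    add_zero]
  rfl

lemma sum_coveringPairs_five (π : Perm (Fin 5)) :
    ∑ I ∈ coveringPairs 5, subsetKernel π I.1 * subsetKernel π I.2 =
      coveringSum (List.ofFn fun i => (π i : ℕ)) := by
  rw [sum_coveringPairs_eq_of_list π
    [(0, 1, 2, 3), (0, 1, 2, 4), (0, 1, 3, 4), (0, 2, 3, 4), (1, 2, 3, 4)]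
    (by decide +kernel) (by decide +kernel) rfl]
  simp +decide only [List.map_cons, List.map_nil, List.sum_cons, List.sum_nil, if_true, if_false,
    add_zero, zero_add]
  simp only [← add_assoc]
  rfl

lemma sum_coveringPairs_six (π : Perm (Fin 6)) :
    ∑ I ∈ coveringPairs 6, subsetKernel π I.1 * subsetKernel π I.2 =
      coveringSum (List.ofFn fun i => (π i : ℕ)) := by
  rw [sum_coveringPairs_eq_of_list π
    [(0, 1, 2, 3), (0, 1, 2, 4), (0, 1, 2, 5), (0, 1, 3, 4), (0, 1, 3, 5), (0, 1, 4, 5),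
      (0, 2, 3, 4), (0, 2, 3, 5), (0, 2, 4, 5), (0, 3, 4, 5), (1, 2, 3, 4), (1, 2, 3, 5),
      (1, 2, 4, 5), (1, 3, 4, 5), (2, 3, 4, 5)]
    (by decide +kernel) (by decide +kernel) rfl]
  simp +decide only [List.map_cons, List.map_nil, List.sum_cons, List.sum_nil, if_true, if_false,
    add_zero, zero_add]
  simp only [← add_assoc]
  rfl

lemma sum_sum_coveringPairs_four :
    ∑ π : Perm (Fin 4), ∑ I ∈ coveringPairs 4, subsetKernel π I.1 * subsetKernel π I.2 = 48 := by
  simp only [sum_coveringPairs_four, sum_perm_eq_sum_permutations]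
  decide +kernel

lemma sum_sum_coveringPairs_five :
    ∑ π : Perm (Fin 5), ∑ I ∈ coveringPairs 5, subsetKernel π I.1 * subsetKernel π I.2 = 768 := by
  simp only [sum_coveringPairs_five, sum_perm_eq_sum_permutations]
  decide +kernel

lemma sum_sum_coveringPairs_six :
    ∑ π : Perm (Fin 6), ∑ I ∈ coveringPairs 6, subsetKernel π I.1 * subsetKernel π I.2 = 2592 := by
  simp only [sum_coveringPairs_six, sum_perm_eq_sum_permutations]
  decide +kernel

lemma sum_sum_coveringPairs_eq_zero {b : ℕ} (hb : 7 ≤ b) :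
    ∑ π : Perm (Fin b), ∑ I ∈ coveringPairs b, subsetKernel π I.1 * subsetKernel π I.2 = 0 := by
  rw [sum_comm]
  refine sum_eq_zero fun I hI => ?_
  obtain ⟨h1, h2, hunion⟩ := (mem_filter.mp hI).2
  refine sum_subsetKernel_mul_subsetKernel_eq_zero h1 ?_
  have hcard := card_union_add_card_inter I.1 I.2
  rw [hunion, card_univ, Fintype.card_fin] at hcard
  omega

/-- Second-order overlap constants `Ω_{τ*,2,b}` for the
Bergsma–Dassios–Yanagimoto pattern kernel.  `pat k π I` is the rank pattern of
`π` on the 4-element subset `I` (characterized by `hpat`). -/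
theorem stmt17
    (B : (Fin 4 → ℝ) → Perm (Fin 4) → ℝ)
    (hB : ∀ u ω, B u ω =
        (if max (u (ω 0)) (u (ω 2)) < min (u (ω 1)) (u (ω 3)) then (1 : ℝ) else 0)
      + (if max (u (ω 1)) (u (ω 3)) < min (u (ω 0)) (u (ω 2)) then (1 : ℝ) else 0)
      - (if max (u (ω 0)) (u (ω 3)) < min (u (ω 1)) (u (ω 2)) then (1 : ℝ) else 0)
      - (if max (u (ω 1)) (u (ω 2)) < min (u (ω 0)) (u (ω 3)) then (1 : ℝ) else 0))
    (vec : Perm (Fin 4) → Fin 4 → ℝ)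
    (hvec : ∀ σ i, vec σ i = ((σ i).val : ℝ) + 1)
    (e : Fin 4 → ℝ) (he : ∀ i, e i = ((i : ℕ) : ℝ) + 1)
    (ψ : Perm (Fin 4) → ℝ)
    (hψ : ∀ σ, ψ σ = (1 / 24) * ∑ ω : Perm (Fin 4), B e ω * B (vec σ) ω)
    (pat : ∀ (k : ℕ), Perm (Fin k) → Finset (Fin k) → Perm (Fin 4))
    (hpat : ∀ (k : ℕ) (π : Perm (Fin k)) (I : Finset (Fin k)) (h : I.card = 4)
        (a b : Fin 4),
        pat k π I a < pat k π I b ↔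
          π ((I.orderIsoOfFin h a : Fin k)) < π ((I.orderIsoOfFin h b : Fin k)))
    (Ω : ℕ → ℝ)
    (hΩ : ∀ b, Ω b = (1 / (b.factorial : ℝ)) * ∑ π : Perm (Fin b),
      ∑ I ∈ Finset.univ.filter (fun I : Finset (Fin b) × Finset (Fin b) =>
          I.1.card = 4 ∧ I.2.card = 4 ∧ I.1 ∪ I.2 = Finset.univ),
        ψ (pat b π I.1) * ψ (pat b π I.2)) :
    Ω 4 = 2 / 9 ∧ Ω 5 = 32 / 45 ∧ Ω 6 = 2 / 5 ∧ Ω 7 = 0 ∧ Ω 8 = 0 := by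
  have hψK (b : ℕ) (π : Perm (Fin b)) (I : Finset (Fin b)) (hI : I.card = 4) :
      ψ (pat b π I) = (subsetKernel π I : ℝ) / 3 := by
    have hBe (ω : Perm (Fin 4)) : B e ω = (signKernel (ω 0) (ω 1) (ω 2) (ω 3) : ℤ) := by
      simp only [hB, he, ite_max_lt_min_eq_toInt_allBelow, signKernel]
      push_cast
      rfl
    have hBvec (σ ω : Perm (Fin 4)) : B (vec σ) ω =
        (signKernel (σ (ω 0)) (σ (ω 1)) (σ (ω 2)) (σ (ω 3)) : ℤ) := by
      simp only [hB, hvec, ite_max_lt_min_eq_toInt_allBelow, signKernel]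
      push_cast
      rfl
    have hsep : sepKernel (pat b π I 0) (pat b π I 1) (pat b π I 2) (pat b π I 3) =
        subsetKernel π I := by
      simp only [subsetKernel, dif_pos hI, sepKernel_eq_ite, Fin.val_fin_lt, hpat b π I hI,
        coe_orderIsoOfFin_apply]
    have hsum := congrArg (Int.cast : ℤ → ℝ) (sum_signKernel_mul_signKernel (pat b π I))
    rw [hsep] at hsum
    push_cast at hsum
    simp only [hψ, hBe, hBvec, hsum]
    ring
  have hΩK (b : ℕ) : Ω b = (1 / (b.factorial : ℝ)) * ((∑ π : Perm (Fin b),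
      ∑ I ∈ coveringPairs b, subsetKernel π I.1 * subsetKernel π I.2 : ℤ) / 9) := by
    rw [hΩ]
    push_cast
    simp only [sum_div]
    refine congrArg _ (sum_congr rfl fun π _ => sum_congr rfl fun I hI => ?_)
    obtain ⟨h1, h2, -⟩ := (mem_filter.mp hI).2
    rw [hψK b π I.1 h1, hψK b π I.2 h2]
    ring
  refine ⟨?_, ?_, ?_, ?_, ?_⟩
  · rw [hΩK, sum_sum_coveringPairs_four]
    norm_num [Nat.factorial]
  · rw [hΩK, sum_sum_coveringPairs_five]
    norm_num [Nat.factorial]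
  · rw [hΩK, sum_sum_coveringPairs_six]
    norm_num [Nat.factorial]
  · rw [hΩK, sum_sum_coveringPairs_eq_zero (by norm_num)]
    norm_num
  · rw [hΩK, sum_sum_coveringPairs_eq_zero (by norm_num)]
    norm_num
end
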